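/- Let S ⊆ 𝒯^D_odd and let π ∈ Π_S. If G has a general thread T for which the restriction of π to the flags of T equals π′_11, then some connected component of the 2-factor D_π is an odd cycle of Ḡ. -/

import Mathlib

namespace FLL

/-! ### Multigraphs -/

variable {V E : Type}

/-- The flags of a multigraph: incident (vertex, edge) pairs. -/
def Flag (ends : E → Sym2 V) : Type := {p : V × E // p.1 ∈ ends p.2}

instance (ends : E → Sym2 V) [Fintype V] [Fintype E] [DecidableEq V] :
    Fintype (Flag ends) := Subtype.fintype _

/-- Degree of a vertex: number of incident edges. -/
def deg [Fintype E] [DecidableEq V] (ends : E → Sym2 V) (v : V) : ℕ :=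
  (Finset.univ.filter fun e => v ∈ ends e).card

/-- A multigraph is loopless if no edge joins a vertex to itself. -/
def Loopless (ends : E → Sym2 V) : Prop := ∀ e, ¬ (ends e).IsDiag

/-- A proper edge colouring: edges sharing an endpoint receive distinct colours. -/
def ProperEdgeColoring (ends : E → Sym2 V) (c : E → ℕ) : Prop :=
  ∀ e e', e ≠ e' → (∃ v, v ∈ ends e ∧ v ∈ ends e') → c e ≠ c e'

/-- `G` is `f`-edge choosable. -/
def EdgeChoosable (ends : E → Sym2 V) (f : E → ℕ) : Prop :=
  ∀ L : E → Finset ℕ, (∀ e, f e ≤ (L e).card) →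
    ∃ c : E → ℕ, ProperEdgeColoring ends c ∧ ∀ e, c e ∈ L e

/-- Reachability avoiding a set `X` of edges. -/
def ReachAvoiding (ends : E → Sym2 V) (X : Set E) : V → V → Prop :=
  Relation.ReflTransGen (fun u v => ∃ e, e ∉ X ∧ ends e = s(u, v))

/-- A cut-edge: its removal disconnects its two endpoints. -/
def IsCutEdge (ends : E → Sym2 V) (e : E) : Prop :=
  ∀ u v : V, ends e = s(u, v) → ¬ ReachAvoiding ends {e} u v

/-- Connectivity of the multigraph. -/
def ConnectedG (ends : E → Sym2 V) : Prop :=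
  ∀ u v : V, ReachAvoiding ends ∅ u v

/-- A planar embedding of a loopless multigraph. -/
structure PlanarEmbedding (ends : E → Sym2 V) where
  vpos : V → ℝ × ℝ
  vinj : Function.Injective vpos
  arc : E → ℝ → ℝ × ℝ
  arc_cont : ∀ e, ContinuousOn (arc e) (Set.Icc 0 1)
  arc_inj : ∀ e, Set.InjOn (arc e) (Set.Icc 0 1)
  arc_ends : ∀ e, Sym2.map vpos (ends e) = s(arc e 0, arc e 1)
  arc_avoid : ∀ e, ∀ t ∈ Set.Ioo (0:ℝ) 1, ∀ v, arc e t ≠ vpos v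
  arc_disjoint : ∀ e e', e ≠ e' → ∀ t ∈ Set.Ioo (0:ℝ) 1, ∀ t' ∈ Set.Ioo (0:ℝ) 1,
    arc e t ≠ arc e' t'

variable [Fintype V] [DecidableEq V] [Fintype E] [DecidableEq E]

/-- A star labelling of `G`: at each vertex `v` the labels of the flags at `v` form a
bijection onto `{0, 1, …, deg v − 1}`. -/
def IsStarLabelling (ends : E → Sym2 V) (π : Flag ends → ℕ) : Prop :=
  ∀ v : V, (Finset.univ.filter (fun fl : Flag ends => fl.1.1 = v)).image π
      = Finset.range (deg ends v)

/-- The exponent of a star labelling: `w_π(e) = π_u(e) + π_v(e)` for `e = uv`. -/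
def exponent (ends : E → Sym2 V) (π : Flag ends → ℕ) : E → ℕ :=
  fun e => ∑ fl ∈ Finset.univ.filter (fun fl : Flag ends => fl.1.2 = e), π fl

/-- The sign of a star labelling relative to a fixed linear ordering of the edges. -/
def starSign [LinearOrder E] (ends : E → Sym2 V) (π : Flag ends → ℕ) : ℤ :=
  ∏ p ∈ Finset.univ.filter
      (fun p : Flag ends × Flag ends => p.1.1.1 = p.2.1.1 ∧ p.1.1.2 < p.2.1.2),
    Int.sign ((π p.2 : ℤ) - (π p.1 : ℤ))

/-! ### Threads -/

/-- Flags of the thread `T_m`: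
`vLeft k = (v_k, e_k)`, `vRight k = (v_{k+1}, e_k)` for `0 ≤ k ≤ m`;
`vFoot k = (v_{k+1}, f_{k+1})`, `wFoot k = (w_{k+1}, f_{k+1})` for `0 ≤ k ≤ m−1`. -/
inductive ThreadFlag (m : ℕ) where
  | vLeft (k : Fin (m+1))
  | vRight (k : Fin (m+1))
  | vFoot (k : Fin m)
  | wFoot (k : Fin m)
deriving DecidableEq

/-- Edges of the thread `T_m`: path edges `e k` (`0 ≤ k ≤ m`) and feet `f k`
(`f k` being the foot edge `f_{k+1}`, `0 ≤ k ≤ m−1`). -/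
inductive ThreadEdge (m : ℕ) where
  | e (k : Fin (m+1))
  | f (k : Fin m)
deriving DecidableEq

namespace Thread

variable {m : ℕ}

/-- The edge a thread flag sits on. -/
def edgeOfFlag : ThreadFlag m → ThreadEdge m
  | .vLeft k => .e k
  | .vRight k => .e k
  | .vFoot k => .f k
  | .wFoot k => .f k

/-- The vertex a thread flag sits on: `inl i` is `v_i`, `inr k` is `w_{k+1}`. -/
def tvert : ThreadFlag m → ℕ ⊕ ℕ
  | .vLeft k => .inl k
  | .vRight k => .inl (k + 1)
  | .vFoot k => .inl (k + 1)
  | .wFoot k => .inr k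

/-- The constant weighting `w_𝟐 ≡ 2`. -/
def w2 : ThreadEdge m → ℕ := fun _ => 2

/-- The weighting `w_11`: as `w_𝟐` except `w(e_0) = 1`, `w(e_m) = 3`. -/
def w11 : ThreadEdge m → ℕ
  | .e k => if (k : ℕ) = 0 then 1 else if (k : ℕ) = m then 3 else 2
  | .f _ => 2

/-- The weighting `w_02`: as `w_𝟐` except `w(e_0) = 1`, `w(f_1) = 3`. -/
def w02 : ThreadEdge m → ℕ
  | .e k => if (k : ℕ) = 0 then 1 else 2
  | .f k => if (k : ℕ) = 0 then 3 else 2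

/-- The weighting `w_20`: as `w_𝟐` except `w(e_0) = 3`, `w(e_1) = 0`, `w(f_1) = 3`. -/
def w20 : ThreadEdge m → ℕ
  | .e k => if (k : ℕ) = 0 then 3 else if (k : ℕ) = 1 then 0 else 2
  | .f k => if (k : ℕ) = 0 then 3 else 2

/-- The 1-footed prestar labelling `ρ_02`. -/
def rho02 : ThreadFlag m → Fin 3
  | .vLeft _ => 0 | .vRight _ => 2 | .vFoot _ => 1 | .wFoot _ => 1

/-- The 1-footed prestar labelling `ρ_20`. -/
def rho20 : ThreadFlag m → Fin 3
  | .vLeft _ => 2 | .vRight _ => 0 | .vFoot _ => 1 | .wFoot _ => 1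

/-- The prestar labelling `ρ_11` of the trivial thread `T_0`. -/
def rho11 : ThreadFlag m → Fin 3 := fun _ => 1

/-- The 1-footed prestar labelling `π_11` (for `m ≥ 1`). -/
def pi11 : ThreadFlag m → Fin 3
  | .vLeft k => if (k : ℕ) = 0 then 1 else 2
  | .vRight k => if (k : ℕ) = m then 1 else 0
  | .vFoot _ => 1 | .wFoot _ => 1

/-- The 1-footed prestar labelling `π_02` (for `m ≥ 1`). -/
def pi02 : ThreadFlag m → Fin 3
  | .vLeft _ => 0
  | .vRight k => if (k : ℕ) = 0 then 1 else 2
  | .vFoot k => if (k : ℕ) = 0 then 2 else 1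
  | .wFoot _ => 1

/-- The 1-footed prestar labelling `π_20` (for `m ≥ 1`). -/
def pi20 : ThreadFlag m → Fin 3
  | .vLeft k => if (k : ℕ) = 1 then 0 else 2
  | .vRight k => if (k : ℕ) = 0 then 1 else 0
  | .vFoot k => if (k : ℕ) = 0 then 2 else 1
  | .wFoot _ => 1

/-- The exceptional 1-footed prestar labelling `π′_11` of `T_1`. -/
def pi'11 : ThreadFlag m → Fin 3
  | .vLeft _ => 1
  | .vRight k => if (k : ℕ) = 0 then 0 else 1
  | .vFoot _ => 2 | .wFoot _ => 1

end Thread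

/-! ### General threads: open, closed and injured -/

/-- The isomorphism type of a general thread: a thread `T_m`, a closed thread `T_m^∘`
(`v_0` identified with `v_{m+1}`), or an injured thread `T_m^−` (the foot vertex
`w_{k+1}` deleted). -/
inductive GK where
  | openT (m : ℕ)
  | closedT (m : ℕ)
  | injuredT (m : ℕ) (k : Fin m)
deriving DecidableEq

/-- The order of a general thread. -/
def GK.order : GK → ℕ
  | .openT m => m
  | .closedT m => m
  | .injuredT m _ => m

/-- The flags of a general thread of the given isomorphism type. -/
def KFlag : GK → Type
  | .openT m => ThreadFlag m
  | .closedT m => ThreadFlag m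
  | .injuredT m k => {fl : ThreadFlag m // fl ≠ .vFoot k ∧ fl ≠ .wFoot k}

/-- The edges of a general thread of the given isomorphism type. -/
def KEdge : GK → Type
  | .openT m => ThreadEdge m
  | .closedT m => ThreadEdge m
  | .injuredT m k => {a : ThreadEdge m // a ≠ .f k}

/-- Inclusion of the flags of a general thread into those of the underlying `T_m`. -/
def flagProj : (g : GK) → KFlag g → ThreadFlag g.order
  | .openT _, fl => fl
  | .closedT _, fl => fl
  | .injuredT _ _, fl => fl.1

/-- Inclusion of the edges of a general thread into those of the underlying `T_m`. -/
def edgeProj : (g : GK) → KEdge g → ThreadEdge g.order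
  | .openT _, a => a
  | .closedT _, a => a
  | .injuredT _ _, a => a.1

/-- The edge of a flag of a general thread. -/
def kedgeOf : (g : GK) → KFlag g → KEdge g
  | .openT _, fl => Thread.edgeOfFlag fl
  | .closedT _, fl => Thread.edgeOfFlag fl
  | .injuredT m k, fl => ⟨Thread.edgeOfFlag fl.1, by
      obtain ⟨fl, h1, h2⟩ := fl
      cases fl <;> simp_all [Thread.edgeOfFlag] <;>
        rintro rfl <;> simp_all⟩

/-- The vertex of a flag of a general thread (`inl i` is `v_i`, `inr k` is `w_{k+1}`);
in a closed thread, `v_{m+1}` is identified with `v_0`. -/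
def kvert : (g : GK) → KFlag g → ℕ ⊕ ℕ
  | .openT _, fl => Thread.tvert fl
  | .closedT m, fl => match Thread.tvert fl with
      | .inl i => .inl (i % (m + 1))
      | .inr i => .inr i
  | .injuredT _ _, fl => Thread.tvert fl.1

/-- The head flag `v_0 e_0` of a general thread. -/
def headFlag : (g : GK) → KFlag g
  | .openT _ => .vLeft 0
  | .closedT _ => .vLeft 0
  | .injuredT _ _ => ⟨.vLeft 0, by simp⟩

/-- The tail flag `v_{m+1} e_m` of a general thread. -/
def tailFlag : (g : GK) → KFlag g
  | .openT m => .vRight (Fin.last m)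
  | .closedT m => .vRight (Fin.last m)
  | .injuredT m _ => ⟨.vRight (Fin.last m), by simp⟩

/-- The eight classes of general threads:
`𝒯^1` (extended vertex blocks), `𝒯^∘_odd`, `𝒯^∘_even` (extended cycle blocks),
`𝒯^M_0`, `𝒯^M_{≥1}` (threads of the derived graph whose edge lies in `M`),
`𝒯^D_odd`, `𝒯^D_even`, `𝒯^D_0` (threads whose edge lies in the 2-factor `D`). -/
inductive TClass where
  | t1 | circOdd | circEven | m0 | mge1 | dOdd | dEven | d0
deriving DecidableEq

open Thread in
open Classical in
/-- The restriction of the weighting `w_S` to a general thread of class `c`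
(`inS` records whether the thread belongs to `S ⊆ 𝒯^D_odd`):  `w_11` on
`𝒯^M_{≥1} ∪ 𝒯^1`, `w_20` on `S`, `w_02` on `(𝒯^D_odd − S) ∪ 𝒯^∘_even`, and `w_𝟐`
otherwise. -/
noncomputable def clsWeight (c : TClass) (inS : Prop) (m : ℕ) : ThreadEdge m → ℕ :=
  match c with
  | .t1 => w11
  | .mge1 => w11
  | .dOdd => if inS then w20 else w02
  | .circEven => w02
  | _ => w2

/-! ### The thread decomposition of a connected planar cubic graph -/

open Thread

/-- A connected loopless planar cubic graph `G` together with its decomposition into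
general threads (Section 4 of the paper): a root proper block has been chosen, the edge
sets of the general threads (extended vertex blocks `≅ T_1^−`, extended cycle blocks
`≅ T_m^∘`, and the threads `T_ē ≅ T_m` or `T_m^−` coming from the edges `ē` of the
derived graph `Ḡ`) partition `E(G)`, and every general thread has been classified into
one of the eight classes of \eqref{eq:allThreads} according to the perfect matching `M`
of `Ḡ` and its complementary bipartite 2-factor `D`.  The field `emb` records, for each
general thread, the identification of its flags with flags of `G` (the choice of head
being built in), `eemb` does the same for edges, and the remaining fields record the
defining properties of the construction. -/
structure Setup where
  /-- vertices of `G` -/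
  V : Type
  /-- edges of `G` -/
  E : Type
  [fintypeV : Fintype V]
  [decEqV : DecidableEq V]
  [fintypeE : Fintype E]
  [decEqE : DecidableEq E]
  /-- the fixed ordering of `E(G)` (used for signs) -/
  [linOrdE : LinearOrder E]
  /-- the incidence of `G` -/
  ends : E → Sym2 V
  loopless : Loopless ends
  cubic : ∀ v, deg ends v = 3
  connected : ConnectedG ends
  planar : Nonempty (PlanarEmbedding ends)
  /-- index set of the general threads -/
  ι : Type
  [fintypeι : Fintype ι]
  [decEqι : DecidableEq ι]
  /-- the isomorphism type of each general thread -/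
  kind : ι → GK
  /-- the class of each general thread -/
  cls : ι → TClass
  /-- the identification of the flags of each general thread with flags of `G` -/
  emb : (t : ι) → KFlag (kind t) → Flag ends
  /-- the identification of the edges of each general thread with edges of `G` -/
  eemb : (t : ι) → KEdge (kind t) → E
  emb_inj : ∀ t, Function.Injective (emb t)
  /-- the flags of the general threads partition the flags of `G` -/
  flag_partition : ∀ fl : Flag ends, ∃! p : Σ t : ι, KFlag (kind t), emb p.1 p.2 = fl
  /-- `emb` and `eemb` are compatible -/
  emb_edge : ∀ t fl, (emb t fl).1.2 = eemb t (kedgeOf (kind t) fl)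
  eemb_inj : Function.Injective (fun p : Σ t : ι, KEdge (kind t) => eemb p.1 p.2)
  /-- two flags of a general thread lie at the same vertex of the thread iff their
  images lie at the same vertex of `G` -/
  emb_vert : ∀ t fl fl', kvert (kind t) fl = kvert (kind t) fl' ↔
      (emb t fl).1.1 = (emb t fl').1.1
  /-- the feet of the general threads lie on cut-edges of `G` -/
  foot_cut : ∀ t (a : KEdge (kind t)), (∃ k, edgeProj (kind t) a = .f k) →
      IsCutEdge ends (eemb t a)
  /-- `𝒯^1`: extended vertex blocks, copies of the injured thread `T_1^−` -/
  cls_t1 : ∀ t, cls t = .t1 → kind t = .injuredT 1 0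
  /-- `𝒯^∘_odd`: extended cycle blocks `≅ T_m^∘` with `m` odd -/
  cls_circOdd : ∀ t, cls t = .circOdd → ∃ m, Odd m ∧ kind t = .closedT m
  /-- `𝒯^∘_even`: extended cycle blocks `≅ T_m^∘` with `m` even (`m ≥ 1`) -/
  cls_circEven : ∀ t, cls t = .circEven → ∃ m, Even m ∧ 1 ≤ m ∧ kind t = .closedT m
  /-- `𝒯^M_0`: trivial threads whose derived edge lies in `M` -/
  cls_m0 : ∀ t, cls t = .m0 → kind t = .openT 0
  /-- `𝒯^D_0`: trivial threads whose derived edge lies in `D` -/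
  cls_d0 : ∀ t, cls t = .d0 → kind t = .openT 0
  /-- `𝒯^M_{≥1}`: nontrivial threads whose derived edge lies in `M` -/
  cls_mge1 : ∀ t, cls t = .mge1 →
      (∃ m, 1 ≤ m ∧ kind t = .openT m) ∨ (∃ m k, kind t = .injuredT m k)
  /-- `𝒯^D_odd`: odd-order threads whose derived edge lies in `D` -/
  cls_dOdd : ∀ t, cls t = .dOdd → ∃ m, Odd m ∧ kind t = .openT m
  /-- `𝒯^D_even`: even-order (`≥ 2`) threads whose derived edge lies in `D` -/
  cls_dEven : ∀ t, cls t = .dEven → ∃ m, Even m ∧ 2 ≤ m ∧ kind t = .openT m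
  /-- closed threads are the extended cycle blocks -/
  closed_cls : ∀ t m, kind t = GK.closedT m → cls t = .circOdd ∨ cls t = .circEven
  /-- every injured thread belongs to `𝒯^M_{≥1} ∪ 𝒯^1`; in particular every base edge
  of `Ḡ` lies in the matching `M` (property (1) of the choice of `M`) -/
  injured_cls : ∀ t m k, kind t = GK.injuredT m k → cls t = .t1 ∨ cls t = .mge1

attribute [instance] Setup.fintypeV Setup.decEqV Setup.fintypeE Setup.decEqE
  Setup.linOrdE Setup.fintypeι Setup.decEqι

namespace Setup

variable (St : Setup)

/-- The general threads arising from edges of the derived graph `Ḡ`. -/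
def isEdgeThread (t : St.ι) : Prop :=
  St.cls t = .m0 ∨ St.cls t = .mge1 ∨ St.cls t = .dOdd ∨ St.cls t = .dEven ∨
    St.cls t = .d0

/-- The perfect matching `M` of `Ḡ`, as a set of edge threads. -/
def inM (t : St.ι) : Prop := St.cls t = .m0 ∨ St.cls t = .mge1

/-- The 2-factor `D = E(Ḡ) − M`, as a set of edge threads. -/
def inD (t : St.ι) : Prop := St.cls t = .dOdd ∨ St.cls t = .dEven ∨ St.cls t = .d0

/-- The vertex of `G` at the head of a general thread; for edge threads this is an
endpoint of the corresponding edge `ē` of `Ḡ`. -/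
def headV (t : St.ι) : St.V := (St.emb t (headFlag (St.kind t))).1.1

/-- The vertex of `G` at the tail of a general thread. -/
def tailV (t : St.ι) : St.V := (St.emb t (tailFlag (St.kind t))).1.1

/-- The branch vertices, i.e. the vertices of the derived graph `Ḡ`. -/
def branchV : Set St.V :=
  {v | ∃ t, St.isEdgeThread t ∧ (St.headV t = v ∨ St.tailV t = v)}

/-- The number of edge-ends of threads satisfying `P` incident with `v`. -/
noncomputable def endCount (P : St.ι → Prop) (v : St.V) : ℕ :=
  {p : St.ι × Bool | P p.1 ∧ (if p.2 then St.tailV p.1 else St.headV p.1) = v}.ncard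

/-- The defining properties of the matching `M`, the bipartite 2-factor `D` and its
cyclic orientation `D⃗` used in the construction:  `M` is a perfect matching of `Ḡ`
whose complement `D` is a 2-factor; `D` is bipartite; subject to the stated conditions
`M` carries the maximum number of nontrivial threads; and `D` has a cyclic orientation
`D⃗` such that the head of every thread in `𝒯^D_odd` is the head of its edge in `D⃗`. -/
def MatchingHyps : Prop :=
  (∀ t, St.isEdgeThread t → St.headV t ≠ St.tailV t) ∧
  -- `M` is a perfect matching of `Ḡ` (each branch vertex meets exactly one `M`-end)
  (∀ v ∈ St.branchV, St.endCount St.inM v = 1) ∧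
  -- `D` is a 2-factor of `Ḡ`
  (∀ v ∈ St.branchV, St.endCount St.inD v = 2) ∧
  -- (2) `D` is bipartite
  (∃ c : St.V → Bool, ∀ t, St.inD t → c (St.headV t) ≠ c (St.tailV t)) ∧
  -- (3) subject to (1) and (2), `M` has as many nontrivial threads as possible
  (∀ M' : St.ι → Prop, (∀ t, M' t → St.isEdgeThread t) →
    (∀ t m k, St.kind t = GK.injuredT m k → St.isEdgeThread t → M' t) →
    (∀ v ∈ St.branchV, St.endCount M' v = 1) →
    (∀ v ∈ St.branchV, St.endCount (fun t => St.isEdgeThread t ∧ ¬ M' t) v = 2) →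
    (∃ c : St.V → Bool, ∀ t, St.isEdgeThread t → ¬ M' t →
        c (St.headV t) ≠ c (St.tailV t)) →
    {t | M' t ∧ 1 ≤ (St.kind t).order}.ncard ≤
      {t | St.inM t ∧ 1 ≤ (St.kind t).order}.ncard) ∧
  -- the cyclic orientation `D⃗` of `D`; `hd t = true` means `ē` points towards `headV t`
  (∃ hd : St.ι → Bool,
    (∀ v ∈ St.branchV,
      {t | St.inD t ∧ (if hd t then St.headV t else St.tailV t) = v}.ncard = 1) ∧
    (∀ v ∈ St.branchV,
      {t | St.inD t ∧ (if hd t then St.tailV t else St.headV t) = v}.ncard = 1) ∧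
    (∀ t, St.cls t = .dOdd → hd t = true))

/-- Membership in `Π_S`: a star labelling of `G` whose exponent is the weighting `w_S`. -/
noncomputable def PiS (S : Set St.ι) (π : Flag St.ends → ℕ) : Prop :=
  IsStarLabelling St.ends π ∧
  ∀ t (a : KEdge (St.kind t)),
    exponent St.ends π (St.eemb t a) =
      clsWeight (St.cls t) (t ∈ S) (St.kind t).order (edgeProj (St.kind t) a)

/-- Membership in `Π = ⋃ {Π_S : S ⊆ 𝒯^D_odd}`. -/
noncomputable def PiMem (π : Flag St.ends → ℕ) : Prop :=
  ∃ S : Set St.ι, (∀ t ∈ S, St.cls t = .dOdd) ∧ St.PiS S π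

/-- The restriction of `π` to the flags of the general thread `t` equals the prestar
labelling `ν` (given uniformly in the order `m`). -/
def RestrEq (t : St.ι) (π : Flag St.ends → ℕ)
    (ν : (m : ℕ) → ThreadFlag m → Fin 3) : Prop :=
  ∀ fl : KFlag (St.kind t),
    π (St.emb t fl) = (ν (St.kind t).order (flagProj (St.kind t) fl) : ℕ)

/-- The restriction of `π` to the flags of `t` is the exceptional labelling `π′_11`
of `T_1`. -/
def RestrIsPi'11 (t : St.ι) (π : Flag St.ends → ℕ) : Prop :=
  St.kind t = GK.openT 1 ∧ St.RestrEq t π (fun _ => pi'11)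

/-- The perfect matching `M_π` of `Ḡ` derived from `π ∈ Π`: the edge threads whose
head and tail flags are both labelled `1` (i.e. whose type is `(1,1)`). -/
def MpiT (π : Flag St.ends → ℕ) : Set St.ι :=
  {t | St.isEdgeThread t ∧ π (St.emb t (headFlag (St.kind t))) = 1 ∧
    π (St.emb t (tailFlag (St.kind t))) = 1}

/-- The complementary 2-factor `D_π = E(Ḡ) − M_π`. -/
def DpiT (π : Flag St.ends → ℕ) : Set St.ι :=
  {t | St.isEdgeThread t ∧ t ∉ St.MpiT π}

/-- `D_π` is bipartite. -/
def DpiBipartite (π : Flag St.ends → ℕ) : Prop :=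
  ∃ c : St.V → Bool, ∀ t ∈ St.DpiT π, c (St.headV t) ≠ c (St.tailV t)

/-- `Π_0`: the star labellings in `Π` whose 2-factor `D_π` is bipartite. -/
noncomputable def Pi0 (π : Flag St.ends → ℕ) : Prop :=
  St.PiMem π ∧ St.DpiBipartite π

/-- `Π_1 = Π − Π_0`. -/
noncomputable def Pi1 (π : Flag St.ends → ℕ) : Prop :=
  St.PiMem π ∧ ¬ St.DpiBipartite π

/-- `C` is an odd cycle of the derived graph `Ḡ` (given as its set of edges). -/
def IsOddCycle (C : Set St.ι) : Prop :=
  (∀ t ∈ C, St.isEdgeThread t) ∧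
  ∃ n : ℕ, Odd n ∧ ∃ (vs : Fin n → St.V) (es : Fin n → St.ι),
    Function.Injective vs ∧ Function.Injective es ∧
    (∀ i, es i ∈ C) ∧ (∀ t ∈ C, ∃ i, es i = t) ∧
    (∀ i, s(St.headV (es i), St.tailV (es i)) = s(vs i, vs (finRotate n i)))

/-- `C` is a connected component of the subgraph of `Ḡ` with edge set `Dset`, and is
an odd cycle. -/
def IsOddCycleComponent (Dset C : Set St.ι) : Prop :=
  St.IsOddCycle C ∧ C ⊆ Dset ∧
  ∀ t ∈ C, ∀ t' ∈ Dset,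
    (St.headV t' = St.headV t ∨ St.headV t' = St.tailV t ∨
     St.tailV t' = St.headV t ∨ St.tailV t' = St.tailV t) → t' ∈ C

/-- `π⁰` is the reference star labelling: the unique member of `Π_∅` with `M_{π⁰} = M`
in which every closed thread of `𝒯^∘_odd` receives the labelling `ρ_02`. -/
noncomputable def IsReference (π : Flag St.ends → ℕ) : Prop :=
  St.PiS ∅ π ∧ St.MpiT π = {t | St.inM t} ∧
  ∀ t, St.cls t = .circOdd → St.RestrEq t π (fun _ => rho02)

end Setup
end FLL

namespace FLL
open Thread
set_option linter.unusedSectionVars false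
set_option linter.unusedVariables false
set_option linter.unusedSimpArgs false

section graph
noncomputable instance flagDecEq {V E : Type} (ends : E → Sym2 V) : DecidableEq (Flag ends) :=
  Classical.decEq _
variable {V E : Type} [Fintype V] [DecidableEq V] [Fintype E] [DecidableEq E]

lemma flag_ext {ends : E → Sym2 V} {f g : Flag ends} (h1 : f.1.1 = g.1.1) (h2 : f.1.2 = g.1.2) :
    f = g := Subtype.ext (Prod.ext h1 h2)

lemma card_flags (ends : E → Sym2 V) (v : V) :
    (Finset.univ.filter (fun fl : Flag ends => fl.1.1 = v)).card = deg ends v := by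
  unfold deg
  refine Finset.card_bij (fun fl _ => fl.1.2) ?_ ?_ ?_
  · intro fl h
    simp only [Finset.mem_filter, Finset.mem_univ, true_and] at h ⊢
    rw [← h]; exact fl.2
  · intro f hf g hg h
    simp only [Finset.mem_filter, Finset.mem_univ, true_and] at hf hg
    exact flag_ext (hf.trans hg.symm) h
  · intro e he
    simp only [Finset.mem_filter, Finset.mem_univ, true_and] at he
    exact ⟨⟨(v, e), he⟩, Finset.mem_filter.2 ⟨Finset.mem_univ _, rfl⟩, rfl⟩

lemma ends_eq {ends : E → Sym2 V} {f g : Flag ends} (hne : f ≠ g) (h : f.1.2 = g.1.2) :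
    ends f.1.2 = s(f.1.1, g.1.1) := by
  have hv : f.1.1 ≠ g.1.1 := fun h' => hne (flag_ext h' h)
  have h1 := f.2
  have h2 := g.2
  rw [← h] at h2
  exact ((Sym2.mem_and_mem_iff hv).1 ⟨h1, h2⟩)

lemma edge_filter {ends : E → Sym2 V} {f g : Flag ends} (hne : f ≠ g) (h : f.1.2 = g.1.2) :
    Finset.univ.filter (fun fl : Flag ends => fl.1.2 = f.1.2) = {f, g} := by
  ext x
  simp only [Finset.mem_filter, Finset.mem_univ, true_and, Finset.mem_insert,
    Finset.mem_singleton]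
  constructor
  · intro hx
    have h1 := x.2
    rw [hx, ends_eq hne h, Sym2.mem_iff] at h1
    rcases h1 with h1 | h1
    · exact Or.inl (flag_ext h1 hx)
    · exact Or.inr (flag_ext h1 (hx.trans h))
  · rintro (rfl | rfl)
    · rfl
    · exact h.symm

lemma exponent_eq {ends : E → Sym2 V} (π : Flag ends → ℕ) {f g : Flag ends} (hne : f ≠ g)
    (h : f.1.2 = g.1.2) : exponent ends π f.1.2 = π f + π g := by
  unfold exponent
  rw [edge_filter hne h, Finset.sum_pair hne]

lemma vert_filter {ends : E → Sym2 V} (hc : ∀ v, deg ends v = 3) {v : V} {f g h : Flag ends}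
    (hf : f.1.1 = v) (hg : g.1.1 = v) (hh : h.1.1 = v) (fg : f ≠ g) (fh : f ≠ h) (gh : g ≠ h) :
    Finset.univ.filter (fun fl : Flag ends => fl.1.1 = v) = {f, g, h} := by
  symm
  apply Finset.eq_of_subset_of_card_le
  · intro x
    simp only [Finset.mem_filter, Finset.mem_univ, true_and, Finset.mem_insert,
      Finset.mem_singleton]
    rintro (rfl | rfl | rfl) <;> assumption
  · rw [card_flags, hc, Finset.card_eq_three.2 ⟨f, g, h, fg, fh, gh, rfl⟩]

/-- no fourth flag at a vertex -/
lemma vert_mem {ends : E → Sym2 V} (hc : ∀ v, deg ends v = 3) {v : V} {f g h : Flag ends}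
    (hf : f.1.1 = v) (hg : g.1.1 = v) (hh : h.1.1 = v) (fg : f ≠ g) (fh : f ≠ h) (gh : g ≠ h)
    {x : Flag ends} (hx : x.1.1 = v) : x = f ∨ x = g ∨ x = h := by
  have : x ∈ Finset.univ.filter (fun fl : Flag ends => fl.1.1 = v) := by simp [hx]
  rw [vert_filter hc hf hg hh fg fh gh] at this
  simpa using this

lemma third_flag {ends : E → Sym2 V} (hc : ∀ v, deg ends v = 3) {v : V} {f g : Flag ends}
    (hf : f.1.1 = v) (hg : g.1.1 = v) (fg : f ≠ g) :
    ∃ h : Flag ends, h.1.1 = v ∧ f ≠ h ∧ g ≠ h := by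
  have h2 : ({f, g} : Finset (Flag ends)).card = 2 := Finset.card_pair fg
  have h3 := card_flags ends v
  rw [hc] at h3
  obtain ⟨x, hx, hx'⟩ := Finset.exists_mem_notMem_of_card_lt_card
    (s := {f, g}) (t := Finset.univ.filter (fun fl : Flag ends => fl.1.1 = v)) (by omega)
  simp only [Finset.mem_insert, Finset.mem_singleton, not_or] at hx'
  exact ⟨x, (Finset.mem_filter.1 hx).2, Ne.symm hx'.1, Ne.symm hx'.2⟩

lemma star_inj {ends : E → Sym2 V} (hc : ∀ v, deg ends v = 3) {π : Flag ends → ℕ}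
    (hπ : IsStarLabelling ends π) {f g : Flag ends} (h : f.1.1 = g.1.1) (hl : π f = π g) :
    f = g := by
  have h1 := hπ g.1.1
  have hcard : (Finset.image π (Finset.univ.filter (fun fl : Flag ends => fl.1.1 = g.1.1))).card
      = (Finset.univ.filter (fun fl : Flag ends => fl.1.1 = g.1.1)).card := by
    rw [h1, card_flags, Finset.card_range]
  exact Finset.card_image_iff.1 hcard (by simp [h]) (by simp) hl

lemma star_exists {ends : E → Sym2 V} (hc : ∀ v, deg ends v = 3) {π : Flag ends → ℕ}
    (hπ : IsStarLabelling ends π) (v : V) (l : ℕ) (hl : l < 3) :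
    ∃ f : Flag ends, f.1.1 = v ∧ π f = l := by
  have h1 := hπ v
  rw [hc] at h1
  have : l ∈ Finset.range 3 := by simpa using hl
  rw [← h1] at this
  simpa using this

lemma star_lt {ends : E → Sym2 V} (hc : ∀ v, deg ends v = 3) {π : Flag ends → ℕ}
    (hπ : IsStarLabelling ends π) (f : Flag ends) : π f < 3 := by
  have h1 := hπ f.1.1
  rw [hc] at h1
  have : π f ∈ Finset.range 3 := by
    rw [← h1]; exact Finset.mem_image_of_mem _ (by simp)
  simpa using this

lemma star_sum {ends : E → Sym2 V} (hc : ∀ v, deg ends v = 3) {π : Flag ends → ℕ}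
    (hπ : IsStarLabelling ends π) {f g h : Flag ends} (h1 : f.1.1 = g.1.1) (h2 : f.1.1 = h.1.1)
    (fg : f ≠ g) (fh : f ≠ h) (gh : g ≠ h) :
    π f + π g + π h = 3 ∧ π f ≠ π g ∧ π f ≠ π h ∧ π g ≠ π h := by
  have a1 : π f ≠ π g := fun h' => fg (star_inj hc hπ h1 h')
  have a2 : π f ≠ π h := fun h' => fh (star_inj hc hπ h2 h')
  have a3 : π g ≠ π h := fun h' => gh (star_inj hc hπ (h1.symm.trans h2) h')
  have b1 := star_lt hc hπ f
  have b2 := star_lt hc hπ g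
  have b3 := star_lt hc hπ h
  refine ⟨by omega, a1, a2, a3⟩

lemma star_vsum {ends : E → Sym2 V} (hc : ∀ v, deg ends v = 3) {π : Flag ends → ℕ}
    (hπ : IsStarLabelling ends π) (v : V) :
    ∑ fl ∈ Finset.univ.filter (fun fl : Flag ends => fl.1.1 = v), ((π fl : ℤ) - 1) = 0 := by
  have h1 := hπ v
  rw [hc] at h1
  have h2 : ∑ fl ∈ Finset.univ.filter (fun fl : Flag ends => fl.1.1 = v), ((π fl : ℤ) - 1)
     = ∑ x ∈ (Finset.univ.filter (fun fl : Flag ends => fl.1.1 = v)).image π, ((x : ℤ) - 1) := by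
    rw [Finset.sum_image]
    intro a ha b hb h
    simp only [Finset.coe_filter, Finset.mem_univ, true_and, Set.mem_ofPred_eq] at ha hb
    exact star_inj hc hπ (ha.trans hb.symm) h
  rw [h2, h1]; decide

end graph

section kinds

def hasFoot : (g : GK) → Fin g.order → Prop
  | .openT _, _ => True
  | .closedT _, _ => True
  | .injuredT _ k', k => k ≠ k'

def kL : (g : GK) → Fin (g.order + 1) → KFlag g
  | .openT _, k => .vLeft k
  | .closedT _, k => .vLeft k
  | .injuredT _ _, k => ⟨.vLeft k, by simp⟩

def kR : (g : GK) → Fin (g.order + 1) → KFlag g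
  | .openT _, k => .vRight k
  | .closedT _, k => .vRight k
  | .injuredT _ _, k => ⟨.vRight k, by simp⟩

def kV : (g : GK) → (k : Fin g.order) → hasFoot g k → KFlag g
  | .openT _, k, _ => .vFoot k
  | .closedT _, k, _ => .vFoot k
  | .injuredT _ _, k, h => ⟨.vFoot k, ⟨fun h' => h (ThreadFlag.vFoot.inj h'), fun h' => nomatch h'⟩⟩

def kW : (g : GK) → (k : Fin g.order) → hasFoot g k → KFlag g
  | .openT _, k, _ => .wFoot k
  | .closedT _, k, _ => .wFoot k
  | .injuredT _ _, k, h => ⟨.wFoot k, ⟨fun h' => (nomatch h'), fun h' => h (ThreadFlag.wFoot.inj h')⟩⟩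

def eE : (g : GK) → Fin (g.order + 1) → KEdge g
  | .openT _, k => .e k
  | .closedT _, k => .e k
  | .injuredT _ _, k => ⟨.e k, by simp⟩

def eF : (g : GK) → (k : Fin g.order) → hasFoot g k → KEdge g
  | .openT _, k, _ => .f k
  | .closedT _, k, _ => .f k
  | .injuredT _ _, k, h => ⟨.f k, fun h' => h (ThreadEdge.f.inj h')⟩

@[simp] lemma proj_kL (g : GK) (k) : flagProj g (kL g k) = .vLeft k := by cases g <;> rfl
@[simp] lemma proj_kR (g : GK) (k) : flagProj g (kR g k) = .vRight k := by cases g <;> rfl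
@[simp] lemma proj_kV (g : GK) (k h) : flagProj g (kV g k h) = .vFoot k := by cases g <;> rfl
@[simp] lemma proj_kW (g : GK) (k h) : flagProj g (kW g k h) = .wFoot k := by cases g <;> rfl
@[simp] lemma proj_eE (g : GK) (k) : edgeProj g (eE g k) = .e k := by cases g <;> rfl
@[simp] lemma proj_eF (g : GK) (k h) : edgeProj g (eF g k h) = .f k := by cases g <;> rfl
@[simp] lemma ke_kL (g : GK) (k) : kedgeOf g (kL g k) = eE g k := by cases g <;> rfl
@[simp] lemma ke_kR (g : GK) (k) : kedgeOf g (kR g k) = eE g k := by cases g <;> rfl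
@[simp] lemma ke_kV (g : GK) (k h) : kedgeOf g (kV g k h) = eF g k h := by cases g <;> rfl
@[simp] lemma ke_kW (g : GK) (k h) : kedgeOf g (kW g k h) = eF g k h := by cases g <;> rfl

lemma head_eq (g : GK) : headFlag g = kL g 0 := by cases g <;> rfl
lemma tail_eq (g : GK) : tailFlag g = kR g (Fin.last _) := by cases g <;> rfl

lemma kvert_RL (g : GK) (i : Fin g.order) :
    kvert g (kR g i.castSucc) = kvert g (kL g i.succ) := by
  cases g <;> simp [kvert, kL, kR, tvert]

lemma kvert_VR (g : GK) (i : Fin g.order) (h) :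
    kvert g (kV g i h) = kvert g (kR g i.castSucc) := by
  cases g <;> simp [kvert, kV, kR, tvert]

lemma kvert_closed (g : GK) (m : ℕ) (h : g = .closedT m) :
    kvert g (kL g 0) = kvert g (kR g (Fin.last _)) := by
  subst h
  simp [kvert, kL, kR, tvert, GK.order]

lemma kflag_cases (g : GK) (x : KFlag g) : (∃ k, x = kL g k) ∨ (∃ k, x = kR g k) ∨
    (∃ k h, x = kV g k h) ∨ (∃ k h, x = kW g k h) := by
  cases g with
  | openT m =>
    cases x with
    | vLeft k => exact Or.inl ⟨k, rfl⟩
    | vRight k => exact Or.inr (Or.inl ⟨k, rfl⟩)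
    | vFoot k => exact Or.inr (Or.inr (Or.inl ⟨k, trivial, rfl⟩))
    | wFoot k => exact Or.inr (Or.inr (Or.inr ⟨k, trivial, rfl⟩))
  | closedT m =>
    cases x with
    | vLeft k => exact Or.inl ⟨k, rfl⟩
    | vRight k => exact Or.inr (Or.inl ⟨k, rfl⟩)
    | vFoot k => exact Or.inr (Or.inr (Or.inl ⟨k, trivial, rfl⟩))
    | wFoot k => exact Or.inr (Or.inr (Or.inr ⟨k, trivial, rfl⟩))
  | injuredT m k' =>
    obtain ⟨x, hx1, hx2⟩ := x
    cases x with
    | vLeft k => exact Or.inl ⟨k, rfl⟩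
    | vRight k => exact Or.inr (Or.inl ⟨k, rfl⟩)
    | vFoot k => exact Or.inr (Or.inr (Or.inl ⟨k, by rintro rfl; simp at hx1, rfl⟩))
    | wFoot k => exact Or.inr (Or.inr (Or.inr ⟨k, by rintro rfl; simp at hx2, rfl⟩))

lemma kedge_cases (g : GK) (x : KEdge g) : (∃ k, x = eE g k) ∨ (∃ k h, x = eF g k h) := by
  cases g with
  | openT m =>
    cases x with
    | e k => exact Or.inl ⟨k, rfl⟩
    | f k => exact Or.inr ⟨k, trivial, rfl⟩
  | closedT m =>
    cases x with
    | e k => exact Or.inl ⟨k, rfl⟩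
    | f k => exact Or.inr ⟨k, trivial, rfl⟩
  | injuredT m k' =>
    obtain ⟨x, hx⟩ := x
    cases x with
    | e k => exact Or.inl ⟨k, rfl⟩
    | f k => exact Or.inr ⟨k, by rintro rfl; simp at hx, rfl⟩

lemma edgeProj_inj (g : GK) : Function.Injective (edgeProj g) := by
  intro a b h
  cases g with
  | openT m => exact h
  | closedT m => exact h
  | injuredT m k => exact Subtype.ext h

open Classical in
lemma kedge_sum (g : GK) [Fintype (KEdge g)] (F : ThreadEdge g.order → ℤ) :
    ∑ a : KEdge g, F (edgeProj g a) =
      ∑ k, F (.e k) + ∑ k, if hasFoot g k then F (.f k) else 0 := by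
  have h1 : (Finset.univ : Finset (KEdge g)) =
      (Finset.univ.image (eE g)) ∪ ((Finset.univ : Finset {k // hasFoot g k}).image
        (fun k => eF g k.1 k.2)) := by
    ext x
    simp only [Finset.mem_univ, Finset.mem_union, Finset.mem_image, true_and, true_iff]
    rcases kedge_cases g x with ⟨k, rfl⟩ | ⟨k, h, rfl⟩
    · exact Or.inl ⟨k, rfl⟩
    · exact Or.inr ⟨⟨k, h⟩, rfl⟩
  rw [h1, Finset.sum_union, Finset.sum_image, Finset.sum_image]
  · congr 1
    · simp
    · simp only [proj_eF]
      rw [← Finset.sum_filter]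
      rw [Finset.sum_subtype (p := hasFoot g) _ (by simp)]
  · rintro ⟨a, ha⟩ _ ⟨b, hb⟩ _ h
    have := congrArg (edgeProj g) h
    simpa using this
  · rintro a _ b _ h
    have := congrArg (edgeProj g) h
    simpa using this
  · rw [Finset.disjoint_left]
    intro x hx hy
    simp only [Finset.mem_univ, Finset.mem_image, true_and] at hx hy
    obtain ⟨a, rfl⟩ := hx
    obtain ⟨b, hb⟩ := hy
    have := congrArg (edgeProj g) hb
    simp at this

lemma foot_of_open (g : GK) (m : ℕ) (h : g = .openT m) (k) : hasFoot g k := by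
  subst h; trivial
lemma foot_of_closed (g : GK) (m : ℕ) (h : g = .closedT m) (k) : hasFoot g k := by
  subst h; trivial

lemma w11_sum (m : ℕ) (hm : 1 ≤ m) : ∑ k, ((w11 (m := m) (.e k) : ℤ) - 2) = 0 := by
  obtain ⟨n, rfl⟩ := Nat.exists_eq_add_of_le' hm
  rw [Fin.sum_univ_succ, Fin.sum_univ_castSucc]
  have : ∀ i : Fin n, ((w11 (m := n+1) (.e i.castSucc.succ) : ℤ) - 2) = 0 := by
    intro i
    have := i.2
    simp [w11]
    omega
  simp only [this]
  simp [w11]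

lemma w02_sum (m : ℕ) (hm : 1 ≤ m) : ∑ k, ((w02 (m := m) (.e k) : ℤ) - 2) +
    ∑ k, ((w02 (m := m) (.f k) : ℤ) - 2) = 0 := by
  obtain ⟨n, rfl⟩ := Nat.exists_eq_add_of_le' hm
  rw [Fin.sum_univ_succ, Fin.sum_univ_succ (fun k => ((w02 (m := n+1) (.f k) : ℤ) - 2))]
  simp [w02]

lemma w20_sum (m : ℕ) (hm : 1 ≤ m) : ∑ k, ((w20 (m := m) (.e k) : ℤ) - 2) +
    ∑ k, ((w20 (m := m) (.f k) : ℤ) - 2) = 0 := by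
  obtain ⟨n, rfl⟩ := Nat.exists_eq_add_of_le' hm
  rw [Fin.sum_univ_succ, Fin.sum_univ_succ (n := n), Fin.sum_univ_succ (n := n)]
  simp [w20]

lemma path_sum (m : ℕ) (w : ThreadEdge m → ℕ) (L R : Fin (m+1) → ℕ)
    (hw : ∑ k, ((w (.e k) : ℤ) - 2) + ∑ k, ((w (.f k) : ℤ) - 2) = 0)
    (hE : ∀ k, L k + R k = w (.e k))
    (hV : ∀ i : Fin m, R i.castSucc + L i.succ + w (.f i) = 4) :
    L 0 + R (Fin.last m) = 2 := by
  have h1 : ∑ k, ((w (.e k) : ℤ) - 2) = ∑ k, ((L k : ℤ) - 1) + ∑ k, ((R k : ℤ) - 1) := by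
    rw [← Finset.sum_add_distrib]
    refine Finset.sum_congr rfl fun k _ => ?_
    rw [← hE k]; push_cast; ring
  rw [h1, Fin.sum_univ_succ, Fin.sum_univ_castSucc (fun k => ((R k : ℤ) - 1))] at hw
  have h2 : ∑ i : Fin m, ((L i.succ : ℤ) - 1) + ∑ i : Fin m, ((R i.castSucc : ℤ) - 1) +
      ∑ k, ((w (.f k) : ℤ) - 2) = 0 := by
    rw [← Finset.sum_add_distrib, ← Finset.sum_add_distrib]
    refine Finset.sum_eq_zero fun k _ => ?_
    have := hV k
    omega
  omega

end kinds
end FLL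

namespace FLL
open Thread
set_option linter.unusedSectionVars false
set_option linter.unusedVariables false
set_option linter.unusedSimpArgs false

def ntag {m : ℕ} : ThreadFlag m → ℕ × ℕ
  | .vLeft k => (0, k)
  | .vRight k => (1, k)
  | .vFoot k => (2, k)
  | .wFoot k => (3, k)

namespace Setup
variable (St : Setup)

def fL (t : St.ι) (k : Fin ((St.kind t).order + 1)) : Flag St.ends := St.emb t (kL (St.kind t) k)
def fR (t : St.ι) (k : Fin ((St.kind t).order + 1)) : Flag St.ends := St.emb t (kR (St.kind t) k)
def fV (t : St.ι) (k) (h : hasFoot (St.kind t) k) : Flag St.ends := St.emb t (kV (St.kind t) k h)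
def fW (t : St.ι) (k) (h : hasFoot (St.kind t) k) : Flag St.ends := St.emb t (kW (St.kind t) k h)

/-- thread and tag of a flag -/
noncomputable def tg (f : Flag St.ends) : St.ι × ℕ × ℕ :=
  ((St.flag_partition f).choose.1, ntag (flagProj _ (St.flag_partition f).choose.2))

lemma tg_emb (t : St.ι) (a) : St.tg (St.emb t a) = (t, ntag (flagProj _ a)) := by
  have h := (St.flag_partition (St.emb t a)).choose_spec.2 ⟨t, a⟩ rfl
  unfold tg
  rw [← h]

@[simp] lemma tg_fL (t : St.ι) (k) : St.tg (St.fL t k) = (t, 0, (k : ℕ)) := by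
  simp [fL, tg_emb, ntag]
@[simp] lemma tg_fR (t : St.ι) (k) : St.tg (St.fR t k) = (t, 1, (k : ℕ)) := by
  simp [fR, tg_emb, ntag]
@[simp] lemma tg_fV (t : St.ι) (k h) : St.tg (St.fV t k h) = (t, 2, (k : ℕ)) := by
  simp [fV, tg_emb, ntag]
@[simp] lemma tg_fW (t : St.ι) (k h) : St.tg (St.fW t k h) = (t, 3, (k : ℕ)) := by
  simp [fW, tg_emb, ntag]

lemma ne_of_tg {f g : Flag St.ends} (h : St.tg f ≠ St.tg g) : f ≠ g := fun e => h (e ▸ rfl)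

lemma flag_cases (f : Flag St.ends) : ∃ t, (∃ k, f = St.fL t k) ∨ (∃ k, f = St.fR t k) ∨
    (∃ k h, f = St.fV t k h) ∨ (∃ k h, f = St.fW t k h) := by
  obtain ⟨⟨t, a⟩, h, -⟩ := St.flag_partition f
  subst h
  refine ⟨t, ?_⟩
  rcases kflag_cases _ a with ⟨k, rfl⟩ | ⟨k, rfl⟩ | ⟨k, h, rfl⟩ | ⟨k, h, rfl⟩
  · exact Or.inl ⟨k, rfl⟩
  · exact Or.inr (Or.inl ⟨k, rfl⟩)
  · exact Or.inr (Or.inr (Or.inl ⟨k, h, rfl⟩))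
  · exact Or.inr (Or.inr (Or.inr ⟨k, h, rfl⟩))

lemma edge_fL (t : St.ι) (k) : (St.fL t k).1.2 = St.eemb t (eE _ k) := by
  rw [fL, St.emb_edge, ke_kL]
lemma edge_fR (t : St.ι) (k) : (St.fR t k).1.2 = St.eemb t (eE _ k) := by
  rw [fR, St.emb_edge, ke_kR]
lemma edge_fV (t : St.ι) (k h) : (St.fV t k h).1.2 = St.eemb t (eF _ k h) := by
  rw [fV, St.emb_edge, ke_kV]
lemma edge_fW (t : St.ι) (k h) : (St.fW t k h).1.2 = St.eemb t (eF _ k h) := by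
  rw [fW, St.emb_edge, ke_kW]

lemma vert_RL (t : St.ι) (i) : (St.fR t (Fin.castSucc i)).1.1 = (St.fL t i.succ).1.1 :=
  (St.emb_vert t _ _).1 (kvert_RL _ i)
lemma vert_VR (t : St.ι) (i h) : (St.fV t i h).1.1 = (St.fR t (Fin.castSucc i)).1.1 :=
  (St.emb_vert t _ _).1 (kvert_VR _ i h)
lemma vert_closed (t : St.ι) (m) (h : St.kind t = .closedT m) :
    (St.fL t 0).1.1 = (St.fR t (Fin.last _)).1.1 :=
  (St.emb_vert t _ _).1 (kvert_closed _ m h)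

lemma LR_ne (t : St.ι) (k) : St.fL t k ≠ St.fR t k := St.ne_of_tg (by simp)
lemma VW_ne (t : St.ι) (k h) : St.fV t k h ≠ St.fW t k h := St.ne_of_tg (by simp)

lemma order_pos_w11 (t : St.ι) (h : St.cls t = .t1 ∨ St.cls t = .mge1) :
    1 ≤ (St.kind t).order := by
  rcases h with h | h
  · rw [St.cls_t1 t h]; simp [GK.order]
  · rcases St.cls_mge1 t h with ⟨m, hm, h⟩ | ⟨m, k, h⟩
    · rw [h]; exact hm
    · rw [h]; have := k.2; simp only [GK.order]; omega

lemma nofoot_cls (t : St.ι) (k) (h : ¬ hasFoot (St.kind t) k) :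
    (∃ m k, St.kind t = .injuredT m k) ∧ (St.cls t = .t1 ∨ St.cls t = .mge1) := by
  rcases hk : St.kind t with m | m | ⟨m, k'⟩
  · exact absurd (foot_of_open _ m hk k) h
  · exact absurd (foot_of_closed _ m hk k) h
  · exact ⟨⟨m, k', rfl⟩, St.injured_cls t m k' hk⟩

section weights
variable (S : Set St.ι)

noncomputable def W (t : St.ι) : ThreadEdge (St.kind t).order → ℕ :=
  clsWeight (St.cls t) (t ∈ S) (St.kind t).order

lemma W_w11 (t : St.ι) (h : St.cls t = .t1 ∨ St.cls t = .mge1) : St.W S t = w11 := by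
  rcases h with h | h <;> simp [W, h, clsWeight]

lemma W_nofoot (t : St.ι) (k) (h : ¬ hasFoot (St.kind t) k) : St.W S t (.f k) = 2 := by
  rw [St.W_w11 S t (St.nofoot_cls t k h).2]; rfl

lemma W_sum (t : St.ι) : ∑ k, ((St.W S t (.e k) : ℤ) - 2) + ∑ k, ((St.W S t (.f k) : ℤ) - 2)
    = 0 := by
  have h2 : St.W S t = w2 → ∑ k, ((St.W S t (.e k) : ℤ) - 2) + ∑ k, ((St.W S t (.f k) : ℤ) - 2)
    = 0 := by
    intro h; rw [h]; simp [w2]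
  rcases hc : St.cls t
  · rw [St.W_w11 S t (Or.inl hc), w11_sum _ (St.order_pos_w11 t (Or.inl hc))]; simp [w11]
  · exact h2 (by simp [W, hc, clsWeight])
  · obtain ⟨m, -, hm, hk⟩ := St.cls_circEven t hc
    have : St.W S t = w02 := by simp [W, hc, clsWeight]
    rw [this]; exact w02_sum _ (by rw [hk]; exact hm)
  · exact h2 (by simp [W, hc, clsWeight])
  · rw [St.W_w11 S t (Or.inr hc), w11_sum _ (St.order_pos_w11 t (Or.inr hc))]; simp [w11]
  · obtain ⟨m, hm, hk⟩ := St.cls_dOdd t hc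
    have hm' : 1 ≤ (St.kind t).order := by rw [hk]; exact hm.pos
    by_cases hS : t ∈ S
    · have : St.W S t = w20 := by simp [W, hc, clsWeight, hS]
      rw [this]; exact w20_sum _ hm'
    · have : St.W S t = w02 := by simp [W, hc, clsWeight, hS]
      rw [this]; exact w02_sum _ hm'
  · exact h2 (by simp [W, hc, clsWeight])
  · exact h2 (by simp [W, hc, clsWeight])

lemma W_ksum (t : St.ι) [Fintype (KEdge (St.kind t))] :
    ∑ a, ((St.W S t (edgeProj _ a) : ℤ) - 2) = 0 := by
  classical
  rw [kedge_sum (St.kind t) (fun x => ((St.W S t x : ℤ) - 2))]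
  refine Eq.trans ?_ (St.W_sum S t)
  congr 1
  refine Finset.sum_congr rfl fun k _ => ?_
  split_ifs with h
  · rfl
  · rw [St.W_nofoot S t k h]; simp

variable {S} {π : Flag St.ends → ℕ}

lemma exp_E (hπ : St.PiS S π) (t : St.ι) (k) : π (St.fL t k) + π (St.fR t k) = St.W S t (.e k) := by
  have h := hπ.2 t (eE _ k)
  rw [proj_eE, ← St.edge_fL, exponent_eq π (St.LR_ne t k)
    ((St.edge_fL t k).trans (St.edge_fR t k).symm)] at h
  exact h

lemma exp_F (hπ : St.PiS S π)
    (t : St.ι) (k h) : π (St.fV t k h) + π (St.fW t k h) = St.W S t (.f k) := by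
  have h' := hπ.2 t (eF _ k h)
  rw [proj_eF, ← St.edge_fV, exponent_eq π (St.VW_ne t k h)
    ((St.edge_fV t k h).trans (St.edge_fW t k h).symm)] at h'
  exact h'
end weights
end Setup
end FLL

namespace FLL
open Thread
namespace Setup
variable (St : Setup)
set_option linter.unusedSectionVars false
set_option linter.unusedVariables false
set_option linter.unusedSimpArgs false

lemma eemb_bij : Function.Bijective
    (fun p : Σ t : St.ι, KEdge (St.kind t) => St.eemb p.1 p.2) := by
  refine ⟨St.eemb_inj, fun e => ?_⟩
  obtain ⟨v, hv⟩ : ∃ v, v ∈ St.ends e := by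
    induction h : St.ends e with
    | _ x y => exact ⟨x, by simp⟩
  obtain ⟨⟨t, a⟩, h, -⟩ := St.flag_partition ⟨(v, e), hv⟩
  refine ⟨⟨t, kedgeOf _ a⟩, ?_⟩
  have := St.emb_edge t a
  simp only at h
  rw [h] at this
  exact this.symm

/-- all flags of a thread lie on the same side of a set closed under the edges, apart from
possibly one foot edge -/
lemma side (K : Set St.V) (e₀ : St.E)
    (hK : ∀ f g : Flag St.ends, f ≠ g → f.1.2 = g.1.2 → f.1.2 ≠ e₀ → (f.1.1 ∈ K ↔ g.1.1 ∈ K))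
    (t : St.ι) (he : ∀ k, St.eemb t (eE _ k) ≠ e₀) :
    (∀ k, (St.fL t k).1.1 ∈ K ↔ (St.fL t 0).1.1 ∈ K) ∧
    (∀ k, (St.fR t k).1.1 ∈ K ↔ (St.fL t 0).1.1 ∈ K) ∧
    (∀ k h, (St.fV t k h).1.1 ∈ K ↔ (St.fL t 0).1.1 ∈ K) := by
  have h0 : ∀ k, (St.fL t k).1.1 ∈ K ↔ (St.fR t k).1.1 ∈ K := fun k =>
    hK _ _ (St.LR_ne t k) ((St.edge_fL t k).trans (St.edge_fR t k).symm)
      (by rw [St.edge_fL]; exact he k)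
  have h1 : ∀ k, (St.fL t k).1.1 ∈ K ↔ (St.fL t 0).1.1 ∈ K := by
    intro k
    induction k using Fin.induction with
    | zero => rfl
    | succ i ih => rw [← St.vert_RL t i, ← h0]; exact ih
  refine ⟨h1, fun k => (h0 k).symm.trans (h1 k), fun k h => ?_⟩
  rw [St.vert_VR t k h, ← h0]; exact h1 _

variable {S : Set St.ι} {π : Flag St.ends → ℕ}

lemma foot_one (hπ : St.PiS S π)
    (t : St.ι) (i) (hi : hasFoot (St.kind t) i) : π (St.fW t i hi) = 1 := by
  classical
  have : ∀ t, Finite (KEdge (St.kind t)) := fun t =>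
    Finite.of_injective (fun a => St.eemb t a) (by
      intro a b h
      have := @St.eemb_inj ⟨t, a⟩ ⟨t, b⟩ h
      simpa using this)
  have : ∀ t, Fintype (KEdge (St.kind t)) := fun t => Fintype.ofFinite _
  set e₀ := St.eemb t (eF _ i hi) with he₀
  have hends : St.ends e₀ = s((St.fW t i hi).1.1, (St.fV t i hi).1.1) := by
    rw [he₀, ← St.edge_fW t i hi]
    exact ends_eq (St.VW_ne t i hi).symm ((St.edge_fW t i hi).trans (St.edge_fV t i hi).symm)
  have hcut : IsCutEdge St.ends e₀ := St.foot_cut t _ ⟨i, by simp⟩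
  set K : Set St.V := {v | ReachAvoiding St.ends {e₀} (St.fW t i hi).1.1 v} with hKdef
  have hw : (St.fW t i hi).1.1 ∈ K := Relation.ReflTransGen.refl
  have hu : (St.fV t i hi).1.1 ∉ K := hcut _ _ hends
  have hK : ∀ f g : Flag St.ends, f ≠ g → f.1.2 = g.1.2 → f.1.2 ≠ e₀ →
      (f.1.1 ∈ K ↔ g.1.1 ∈ K) := by
    have key : ∀ f g : Flag St.ends, f ≠ g → f.1.2 = g.1.2 → f.1.2 ≠ e₀ →
      (f.1.1 ∈ K → g.1.1 ∈ K) := fun f g hne he h0 hf =>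
        Relation.ReflTransGen.tail hf ⟨f.1.2, by simpa using h0, ends_eq hne he⟩
    exact fun f g hne he h0 => ⟨key f g hne he h0, key g f hne.symm he.symm (he ▸ h0)⟩
  -- the weight of an edge inside `K`
  let F : Flag St.ends → ℤ := fun fl => if fl.1.1 ∈ K then (π fl : ℤ) - 1 else 0
  let H : St.E → ℤ := fun e => ∑ fl ∈ Finset.univ.filter (fun fl : Flag St.ends => fl.1.2 = e), F fl
  have hH : ∀ f g : Flag St.ends, f ≠ g → f.1.2 = g.1.2 → H f.1.2 = F f + F g := by
    intro f g hne he
    simp only [H]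
    rw [edge_filter hne he, Finset.sum_pair hne]
  have htot : ∑ e, H e = 0 := by
    simp only [H]
    rw [Finset.sum_fiberwise]
    rw [← Finset.sum_fiberwise Finset.univ (fun fl : Flag St.ends => fl.1.1) F]
    refine Finset.sum_eq_zero fun v _ => ?_
    by_cases hv : v ∈ K
    · rw [← star_vsum St.cubic hπ.1 v]
      refine Finset.sum_congr rfl fun fl hfl => ?_
      have : fl.1.1 = v := (Finset.mem_filter.1 hfl).2
      simp only [F]
      rw [if_pos (this ▸ hv)]
    · refine Finset.sum_eq_zero fun fl hfl => ?_
      have : fl.1.1 = v := (Finset.mem_filter.1 hfl).2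
      simp only [F]
      rw [if_neg (this ▸ hv)]
  have hEne : ∀ t' k, St.eemb t' (eE _ k) ≠ e₀ := by
    intro t' k h
    rw [← St.edge_fL] at h
    have h3 := edge_filter (St.VW_ne t i hi) ((St.edge_fV t i hi).trans (St.edge_fW t i hi).symm)
    have h4 : St.fL t' k ∈ ({St.fV t i hi, St.fW t i hi} : Finset (Flag St.ends)) := by
      rw [← h3, Finset.mem_filter]
      exact ⟨Finset.mem_univ _, h.trans (St.edge_fV t i hi).symm⟩
    simp only [Finset.mem_insert, Finset.mem_singleton] at h4
    rcases h4 with h4 | h4 <;> simpa using congrArg St.tg h4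
  have hval : ∀ t' (a : KEdge (St.kind t')), St.eemb t' a ≠ e₀ →
      H (St.eemb t' a) = if (St.fL t' 0).1.1 ∈ K then ((St.W S t' (edgeProj _ a) : ℤ) - 2)
        else 0 := by
    intro t' a ha
    obtain ⟨s1, s2, s3⟩ := St.side K e₀ hK t' (hEne t')
    rcases kedge_cases _ a with ⟨k, rfl⟩ | ⟨k, h, rfl⟩
    · rw [← St.edge_fL, hH _ _ (St.LR_ne t' k) ((St.edge_fL t' k).trans (St.edge_fR t' k).symm)]
      simp only [F, s1 k, s2 k, proj_eE, ← St.exp_E hπ t' k]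
      split_ifs
      · push_cast; ring
      · rfl
    · have h1 := (St.edge_fV t' k h).trans (St.edge_fW t' k h).symm
      have h2 := hK _ _ (St.VW_ne t' k h) h1 (by rw [St.edge_fV]; exact ha)
      rw [← St.edge_fV, hH _ _ (St.VW_ne t' k h) h1]
      simp only [F, ← h2, s3 k h, proj_eF, ← St.exp_F hπ t' k h]
      split_ifs
      · push_cast; ring
      · rfl
  have hsum : ∑ e, H e = ∑ t', ∑ a, H (St.eemb t' a) := by
    rw [← (St.eemb_bij).sum_comp H, Fintype.sum_sigma]
  have hother : ∀ t', t' ≠ t → ∑ a, H (St.eemb t' a) = 0 := by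
    intro t' hne
    have : ∀ a, St.eemb t' a ≠ e₀ := by
      intro a h
      have := @St.eemb_inj ⟨t', a⟩ ⟨t, eF _ i hi⟩ h
      exact hne (congrArg Sigma.fst this)
    rw [Finset.sum_congr rfl (fun a _ => hval t' a (this a))]
    split_ifs
    · exact St.W_ksum S t'
    · simp
  have hmain : ∑ a, H (St.eemb t a) = H e₀ := by
    refine Finset.sum_eq_single (eF _ i hi) ?_ (by simp)
    intro a _ hne
    have : St.eemb t a ≠ e₀ := by
      intro h
      have := @St.eemb_inj ⟨t, a⟩ ⟨t, eF _ i hi⟩ h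
      exact hne (by simpa using this)
    rw [hval t a this, if_neg]
    rw [← (St.side K e₀ hK t (hEne t)).2.2 i hi]
    exact hu
  rw [htot, Finset.sum_eq_single t (fun t' _ h => hother t' h) (by simp), hmain, he₀,
    ← St.edge_fV t i hi, hH _ _ (St.VW_ne t i hi)
      ((St.edge_fV t i hi).trans (St.edge_fW t i hi).symm)] at hsum
  simp only [F] at hsum
  rw [if_neg hu, if_pos hw] at hsum
  omega

end Setup
end FLL

namespace FLL
open Thread
namespace Setup
variable (St : Setup)
set_option linter.unusedSectionVars false
set_option linter.unusedVariables false
set_option linter.unusedSimpArgs false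

lemma headV_eq (t : St.ι) : St.headV t = (St.fL t 0).1.1 := by
  rw [headV, head_eq]; rfl
lemma tailV_eq (t : St.ι) : St.tailV t = (St.fR t (Fin.last _)).1.1 := by
  rw [tailV, tail_eq]; rfl

def endF (p : St.ι × Bool) : Flag St.ends := if p.2 then St.fR p.1 (Fin.last _) else St.fL p.1 0

lemma endF_inj : Function.Injective St.endF := by
  rintro ⟨t, b⟩ ⟨t', b'⟩ h
  have := congrArg St.tg h
  cases b <;> cases b' <;> simp [endF] at this <;> simp [this]

lemma endF_vert (p : St.ι × Bool) :
    (if p.2 then St.tailV p.1 else St.headV p.1) = (St.endF p).1.1 := by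
  rw [headV_eq, tailV_eq, endF]; split_ifs <;> rfl

lemma edge_iff (t : St.ι) : St.isEdgeThread t ↔ St.inM t ∨ St.inD t := by
  unfold isEdgeThread inM inD; tauto

lemma not_inM_inD (t : St.ι) (h : St.inM t) : ¬ St.inD t := by
  unfold inM inD at *
  rcases h with h | h <;> simp [h]


lemma endCount_edge (hM : St.MatchingHyps)
    (x : St.V) (hx : x ∈ St.branchV) : St.endCount St.isEdgeThread x = 3 := by
  have h1 := hM.2.1 x hx
  have h2 := hM.2.2.1 x hx
  unfold endCount at *
  have : {p : St.ι × Bool | St.isEdgeThread p.1 ∧ (if p.2 then St.tailV p.1 else St.headV p.1) = x}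
    = {p : St.ι × Bool | St.inM p.1 ∧ (if p.2 then St.tailV p.1 else St.headV p.1) = x} ∪
      {p : St.ι × Bool | St.inD p.1 ∧ (if p.2 then St.tailV p.1 else St.headV p.1) = x} := by
    ext p
    simp only [Set.mem_ofPred_eq, Set.mem_union, St.edge_iff]
    tauto
  rw [this, Set.ncard_union_eq ?_ (Set.toFinite _) (Set.toFinite _), h1, h2]
  rw [Set.disjoint_left]
  rintro p ⟨hp, -⟩ ⟨hp', -⟩
  exact St.not_inM_inD _ hp hp'

lemma branch_flag (hM : St.MatchingHyps) (f : Flag St.ends) (hx : f.1.1 ∈ St.branchV) :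
    ∃ p : St.ι × Bool, St.isEdgeThread p.1 ∧ f = St.endF p := by
  have h3 := St.endCount_edge hM _ hx
  unfold endCount at h3
  have hcard := card_flags St.ends f.1.1
  rw [St.cubic] at hcard
  have := Finset.eq_of_subset_of_card_le
    (s := ((Set.toFinite {p : St.ι × Bool | St.isEdgeThread p.1 ∧
      (if p.2 then St.tailV p.1 else St.headV p.1) = f.1.1}).toFinset).image St.endF)
    (t := Finset.univ.filter (fun fl : Flag St.ends => fl.1.1 = f.1.1)) (by
      intro y hy
      rw [Finset.mem_image] at hy
      obtain ⟨p, hp, rfl⟩ := hy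
      rw [Set.Finite.mem_toFinset] at hp
      rw [Finset.mem_filter]
      exact ⟨Finset.mem_univ _, (St.endF_vert p).symm.trans hp.2⟩) (by
      rw [Finset.card_image_of_injective _ St.endF_inj, hcard,
        ← Set.ncard_eq_toFinset_card, h3])
  have hf : f ∈ Finset.univ.filter (fun fl : Flag St.ends => fl.1.1 = f.1.1) := by
    rw [Finset.mem_filter]; exact ⟨Finset.mem_univ _, rfl⟩
  rw [← this, Finset.mem_image] at hf
  obtain ⟨p, hp, h⟩ := hf
  rw [Set.Finite.mem_toFinset] at hp
  exact ⟨p, hp.1, h.symm⟩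

/-- The third flag at an injured vertex. -/
lemma injured_third (hM : St.MatchingHyps)
    (t : St.ι) (k) (hk : ¬ hasFoot (St.kind t) k) (f : Flag St.ends)
    (hf : f.1.1 = (St.fR t (Fin.castSucc k)).1.1) (h1 : St.fR t (Fin.castSucc k) ≠ f)
    (h2 : St.fL t k.succ ≠ f) :
    (∃ t' i h, f = St.fW t' i h) ∨ (∃ p : St.ι × Bool, St.cls p.1 = .t1 ∧ f = St.endF p) := by
  have hRL : St.fR t (Fin.castSucc k) ≠ St.fL t k.succ := St.ne_of_tg (by simp)
  have four : ∀ g : Flag St.ends, g.1.1 = f.1.1 → g ≠ f →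
      g = St.fR t (Fin.castSucc k) ∨ g = St.fL t k.succ := by
    intro g hg hgf
    rcases vert_mem St.cubic rfl (St.vert_RL t k).symm hf hRL h1 h2 (hg.trans hf)
      with h | h | h
    · exact Or.inl h
    · exact Or.inr h
    · exact absurd h hgf
  have hinj := (St.nofoot_cls t k hk).1
  have hnb : f.1.1 ∉ St.branchV := by
    intro hb
    rw [hf] at hb
    obtain ⟨⟨t', b⟩, -, h⟩ := St.branch_flag hM _ hb
    have := congrArg St.tg h
    have hk2 := k.2
    cases b <;> simp [endF] at this
    obtain ⟨rfl, h'⟩ := this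
    omega
  have hend : ∀ p : St.ι × Bool, f = St.endF p → St.cls p.1 = .t1 := by
    rintro p rfl
    by_contra hne
    by_cases he : St.isEdgeThread p.1
    · apply hnb
      refine ⟨p.1, he, ?_⟩
      have := St.endF_vert p
      split_ifs at this
      · exact Or.inr this
      · exact Or.inl this
    · have hcl : ∃ m, St.kind p.1 = .closedT m := by
        unfold isEdgeThread at he
        rcases hc : St.cls p.1 <;> simp [hc] at he hne
        · obtain ⟨m, -, h⟩ := St.cls_circOdd _ hc; exact ⟨m, h⟩
        · obtain ⟨m, -, -, h⟩ := St.cls_circEven _ hc; exact ⟨m, h⟩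
      obtain ⟨m, hm⟩ := hcl
      have hv := St.vert_closed p.1 m hm
      have htne : p.1 ≠ t := by
        rintro h
        obtain ⟨m', k', h'⟩ := hinj
        rw [h, h'] at hm
        cases hm
      obtain ⟨t', b⟩ := p
      cases b
      · rcases four (St.fR t' (Fin.last _)) (by simpa [endF] using hv.symm)
          (St.ne_of_tg (by simp [endF])) with h | h <;>
        · have := congrArg St.tg h
          simp [htne] at this
          try exact htne this.1
      · rcases four (St.fL t' 0) (by simpa [endF] using hv)
          (St.ne_of_tg (by simp [endF])) with h | h <;>
        · have := congrArg St.tg h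
          simp [htne] at this
          try exact htne this.1
  obtain ⟨t', ⟨j, rfl⟩ | ⟨j, rfl⟩ | ⟨i, h, rfl⟩ | ⟨i, h, rfl⟩⟩ := St.flag_cases f
  · right
    refine ⟨(t', false), ?_⟩
    cases j using Fin.cases with
    | zero => exact ⟨hend (t', false) (by simp [endF]), by simp [endF]⟩
    | succ i =>
      exfalso
      rcases four (St.fR t' i.castSucc) (St.vert_RL t' i) (St.ne_of_tg (by simp)) with h | h
      · have := congrArg St.tg h
        simp at this
        obtain ⟨rfl, h'⟩ := this
        exact h2 (by rw [Fin.ext h'])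
      · have := congrArg St.tg h
        simp at this
  · right
    refine ⟨(t', true), ?_⟩
    cases j using Fin.lastCases with
    | last => exact ⟨hend (t', true) (by simp [endF]), by simp [endF]⟩
    | cast i =>
      exfalso
      rcases four (St.fL t' i.succ) (St.vert_RL t' i).symm (St.ne_of_tg (by simp)) with h | h
      · have := congrArg St.tg h
        simp at this
      · have := congrArg St.tg h
        simp at this
        obtain ⟨rfl, h'⟩ := this
        exact h1 (by rw [Fin.ext h'])
  · exfalso
    rcases four (St.fR t' i.castSucc) (St.vert_VR t' i h).symm (St.ne_of_tg (by simp)) with h' | h'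
    · have := congrArg St.tg h'
      simp at this
      obtain ⟨rfl, h''⟩ := this
      exact hk ((Fin.ext h'' : i = k) ▸ h)
    · have := congrArg St.tg h'
      simp at this
  · exact Or.inl ⟨t', i, h, rfl⟩

end Setup
end FLL

namespace FLL
open Thread

lemma nofoot_t1 (g : GK) (h : g = .injuredT 1 0) (k) : ¬ hasFoot g k := by
  subst h
  have : k = (0 : Fin 1) := Subsingleton.elim (α := Fin 1) _ _
  subst this
  exact fun h => h rfl

namespace Setup
variable (St : Setup)
set_option linter.unusedSectionVars false
set_option linter.unusedVariables false
set_option linter.unusedSimpArgs false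

lemma interior_unique (t t' : St.ι) (i i')
    (h : (St.fR t (Fin.castSucc i)).1.1 = (St.fR t' (Fin.castSucc i')).1.1) : t = t' := by
  by_contra hne
  rcases vert_mem St.cubic (f := St.fR t (Fin.castSucc i)) (g := St.fL t i.succ)
    (h := St.fR t' (Fin.castSucc i')) rfl (St.vert_RL t i).symm h.symm
    (St.ne_of_tg (by simp)) (St.ne_of_tg (by simp [hne])) (St.ne_of_tg (by simp))
    (x := St.fL t' i'.succ) ((St.vert_RL t' i').symm.trans h.symm) with h | h | h <;>
  · have := congrArg St.tg h
    simp at this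
    try exact hne this.1.symm

variable  {S : Set St.ι} {π : Flag St.ends → ℕ}

lemma t1_labels (hπ : St.PiS S π)
    (t : St.ι) (ht : St.cls t = .t1) (i : Fin (St.kind t).order) (f : Flag St.ends)
    (hf : f.1.1 = (St.fR t (Fin.castSucc i)).1.1) (h1 : St.fR t (Fin.castSucc i) ≠ f)
    (h2 : St.fL t i.succ ≠ f) (b : Bool) (hb : π (St.endF (t, b)) ≠ 1) :
    π f ≠ 1 ∧ π (St.endF (t, !b)) = 1 := by
  have ho : (St.kind t).order = 1 := by rw [St.cls_t1 t ht]; rfl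
  have hi0 : Fin.castSucc i = 0 := by
    apply Fin.ext; have := i.2; simp; omega
  have hil : i.succ = Fin.last _ := by
    apply Fin.ext; have := i.2; simp; omega
  have hW := St.W_w11 S t (Or.inl ht)
  have e0 := St.exp_E hπ t 0
  have e1 := St.exp_E hπ t (Fin.last _)
  have s := star_sum St.cubic hπ.1 (St.vert_RL t i) hf.symm (St.ne_of_tg (by simp)) h1 h2
  rw [hW] at e0 e1
  rw [hi0, hil] at s
  simp only [w11, Fin.val_zero, Fin.val_last, ho] at e0 e1
  norm_num at e0 e1
  have l1 := star_lt St.cubic hπ.1 (St.fR t (Fin.last _))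
  have l2 := star_lt St.cubic hπ.1 (St.fL t (Fin.last _))
  have l3 := star_lt St.cubic hπ.1 f
  cases b <;> simp [endF] at hb ⊢ <;> omega


lemma t1_end_center (hM : St.MatchingHyps) (hπ : St.PiS S π)
    (p : St.ι × Bool) (hp : St.cls p.1 = .t1) (hl : π (St.endF p) ≠ 1) :
    ∃ t i, St.cls t = .t1 ∧ (St.endF p).1.1 = (St.fR t (Fin.castSucc i)).1.1 := by
  classical
  let X : Set (Flag St.ends) := {f | (∃ p, St.cls p.1 = .t1 ∧ f = St.endF p) ∧ π f ≠ 1}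
  have step : ∀ f : X, ∃ g : X, ∃ t i b, St.cls t = .t1 ∧ f.1 = St.endF (t, b) ∧
      π (St.endF (t, !b)) = 1 ∧ (g.1).1.1 = (St.fR t (Fin.castSucc i)).1.1 := by
    rintro ⟨f, ⟨⟨t, b⟩, ht, hf⟩, hl⟩
    simp only at ht
    have ho : (St.kind t).order = 1 := by rw [St.cls_t1 t ht]; rfl
    let i : Fin (St.kind t).order := ⟨0, by omega⟩
    obtain ⟨g, hg, hg1, hg2⟩ := third_flag St.cubic (f := St.fR t (Fin.castSucc i))
      (g := St.fL t i.succ) rfl (St.vert_RL t i).symm (St.ne_of_tg (by simp))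
    have hlab := St.t1_labels hπ t ht i g hg hg1 hg2 b (hf ▸ hl)
    have hgX : g ∈ X := by
      refine ⟨?_, hlab.1⟩
      rcases St.injured_third hM t i (nofoot_t1 _ (St.cls_t1 t ht) i) g hg hg1 hg2 with
        ⟨t', j, h, rfl⟩ | h
      · exact absurd (St.foot_one hπ t' j h) hlab.1
      · exact h
    exact ⟨⟨g, hgX⟩, t, i, b, ht, hf, hlab.2, hg⟩
  choose φ hφ using step
  have hinj : Function.Injective φ := by
    intro f f' h
    obtain ⟨t, i, b, ht, hf, hb, hg⟩ := hφ f
    obtain ⟨t', i', b', ht', hf', hb', hg'⟩ := hφ f'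
    rw [h] at hg
    obtain rfl := St.interior_unique t t' i i' (hg.symm.trans hg')
    apply Subtype.ext
    rw [hf, hf']
    have hlf := f.2.2
    have hlf' := f'.2.2
    rw [hf] at hlf
    rw [hf'] at hlf'
    cases b <;> cases b' <;> simp_all
  have hsurj := Finite.surjective_of_injective hinj
  obtain ⟨f, hf⟩ := hsurj ⟨St.endF p, ⟨p, hp, rfl⟩, hl⟩
  obtain ⟨t, i, b, ht, -, -, hg⟩ := hφ f
  rw [hf] at hg
  exact ⟨t, i, ht, hg⟩

/-- Every interior vertex of an edge thread has a third flag, of label one less than the weight of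
the foot. -/
lemma interior_third (hM : St.MatchingHyps) (hπ : St.PiS S π)
    (t : St.ι) (ht : St.isEdgeThread t) (i : Fin (St.kind t).order) :
    ∃ f : Flag St.ends, f.1.1 = (St.fR t (Fin.castSucc i)).1.1 ∧ St.fR t (Fin.castSucc i) ≠ f ∧
      St.fL t i.succ ≠ f ∧ π f + 1 = St.W S t (.f i) := by
  by_cases hi : hasFoot (St.kind t) i
  · refine ⟨St.fV t i hi, St.vert_VR t i hi, St.ne_of_tg (by simp), St.ne_of_tg (by simp), ?_⟩
    rw [← St.exp_F hπ t i hi, St.foot_one hπ t i hi]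
  · obtain ⟨g, hg, hg1, hg2⟩ := third_flag St.cubic (f := St.fR t (Fin.castSucc i))
      (g := St.fL t i.succ) rfl (St.vert_RL t i).symm (St.ne_of_tg (by simp))
    refine ⟨g, hg, hg1, hg2, ?_⟩
    rw [St.W_nofoot S t i hi]
    suffices π g = 1 by omega
    rcases St.injured_third hM t i hi g hg hg1 hg2 with ⟨t', j, h, rfl⟩ | ⟨p, hp, rfl⟩
    · exact St.foot_one hπ t' j h
    · by_contra hne
      obtain ⟨t', i', ht', hv⟩ := St.t1_end_center hM hπ p hp hne
      obtain rfl := St.interior_unique t t' i i' (hg.symm.trans hv)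
      unfold isEdgeThread at ht
      simp [ht'] at ht

lemma type_sum (hM : St.MatchingHyps) (hπ : St.PiS S π) (t : St.ι) (ht : St.isEdgeThread t) :
    π (St.fL t 0) + π (St.fR t (Fin.last _)) = 2 := by
  refine path_sum _ (St.W S t) (fun k => π (St.fL t k)) (fun k => π (St.fR t k)) (St.W_sum S t)
    (St.exp_E hπ t) (fun i => ?_)
  obtain ⟨f, hf, h1, h2, hl⟩ := St.interior_third hM hπ t ht i
  have := star_sum St.cubic hπ.1 (St.vert_RL t i) hf.symm (St.ne_of_tg (by simp)) h1 h2
  omega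

lemma mge1_head (hM : St.MatchingHyps) (hπ : St.PiS S π)
    (t : St.ι) (ht : St.cls t = .mge1) : π (St.fL t 0) = 1 := by
  have ho := St.order_pos_w11 t (Or.inr ht)
  let i : Fin (St.kind t).order := ⟨0, by omega⟩
  have hi0 : Fin.castSucc i = 0 := rfl
  obtain ⟨f, hf, h1, h2, hl⟩ := St.interior_third hM hπ t (Or.inr (Or.inl ht)) i
  have hs := star_sum St.cubic hπ.1 (St.vert_RL t i) hf.symm (St.ne_of_tg (by simp)) h1 h2
  have e0 := St.exp_E hπ t 0
  rw [St.W_w11 S t (Or.inr ht)] at e0 hl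
  rw [hi0] at hs
  simp [w11] at e0 hl
  omega

end Setup
end FLL

namespace FLL
open Thread
set_option linter.unusedSectionVars false
set_option linter.unusedVariables false
set_option linter.unusedSimpArgs false

/-- A finite functional 2-factor is bipartite or has an odd cycle component. -/
lemma two_factor {X I : Type} [Finite X] (a : I ≃ X) (b : I → X) (hb : Function.Injective b) :
    (∃ c : X → Bool, ∀ t, c (a t) ≠ c (b t)) ∨
    ∃ (C : Set I) (n : ℕ), Odd n ∧ (∃ (vs : Fin n → X) (es : Fin n → I),
      Function.Injective vs ∧ Function.Injective es ∧ (∀ i, es i ∈ C) ∧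
      (∀ t ∈ C, ∃ i, es i = t) ∧ ∀ i, a (es i) = vs i ∧ b (es i) = vs (finRotate n i)) ∧
      ∀ t ∈ C, ∀ t', (a t' = a t ∨ a t' = b t ∨ b t' = a t ∨ b t' = b t) → t' ∈ C := by
  classical
  let σ : Equiv.Perm X := Equiv.ofBijective (b ∘ a.symm)
    (Finite.injective_iff_bijective.1 (hb.comp a.symm.injective))
  have hσ : ∀ t, σ (a t) = b t := fun t => by simp [σ]
  by_cases hodd : ∃ x, Odd (Function.minimalPeriod σ x)
  · right
    obtain ⟨x, hx⟩ := hodd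
    refine ⟨{t | σ.SameCycle x (a t)}, Function.minimalPeriod σ x, hx, ?_, ?_⟩
    · set n := Function.minimalPeriod σ x with hn
      have hnpos : 0 < n := hx.pos
      have hit : ∀ i : Fin n, σ^[(finRotate n i : ℕ)] x = σ^[(i : ℕ) + 1] x := by
        intro i
        obtain ⟨m, hm⟩ : ∃ m, n = m + 1 := ⟨n - 1, by omega⟩
        have hval : ((finRotate n i : Fin n) : ℕ) = ((i : ℕ) + 1) % n := by
          clear_value n
          subst hm
          rw [finRotate_succ_apply, Fin.val_add]
          simp
        rw [hval]; exact Function.iterate_mod_minimalPeriod_eq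
      have hvs : Function.Injective (fun i : Fin n => σ^[(i : ℕ)] x) := by
        intro i j h
        exact Fin.ext (Function.iterate_injOn_Iio_minimalPeriod (f := σ) (x := x)
          (Set.mem_Iio.2 i.2) (Set.mem_Iio.2 j.2) h)
      refine ⟨fun i => σ^[(i : ℕ)] x, fun i => a.symm (σ^[(i : ℕ)] x), hvs,
        a.symm.injective.comp hvs, ?_, ?_, ?_⟩
      · intro i
        refine ⟨(i : ℕ), ?_⟩
        simp
        rw [Equiv.Perm.iterate_eq_pow]
      · rintro t ⟨k, hk⟩
        have hnz : (n : ℤ) ≠ 0 := by omega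
        have hk1 : ((k % n).toNat : ℤ) = k % n := Int.toNat_of_nonneg (Int.emod_nonneg _ hnz)
        have hk2 := Int.emod_lt_of_pos k (b := (n : ℤ)) (by omega)
        refine ⟨⟨(k % n).toNat, by omega⟩, ?_⟩
        rw [Equiv.symm_apply_eq, ← hk]
        have h3 : (σ ^ ((n : ℤ) * (k / n))) x = x := by
          have := (MulAction.zpow_smul_eq_iff_minimalPeriod_dvd (a := σ) (b := x)
            (n := (n : ℤ) * (k / n))).2 (Dvd.intro _ rfl)
          exact this
        conv_rhs => rw [← Int.emod_add_mul_ediv k n, zpow_add, Equiv.Perm.mul_apply, h3, ← hk1]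
        rw [zpow_natCast, Equiv.Perm.iterate_eq_pow]
      · intro i
        refine ⟨by simp, ?_⟩
        rw [← hσ, a.apply_symm_apply]
        simp only
        rw [hit, Function.iterate_succ_apply']
    · intro t ht t' h
      simp only [Set.mem_ofPred_eq, ← hσ] at *
      rcases h with h | h | h | h
      · rw [h]; exact ht
      · rw [h]; exact ht.trans (Equiv.Perm.sameCycle_apply_right.2 (Equiv.Perm.SameCycle.refl _ _))
      · rw [← h] at ht; exact Equiv.Perm.sameCycle_apply_right.1 ht
      · rw [σ.injective h]; exact ht
  · left
    push Not at hodd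
    let r : X → X := fun x => (Quotient.mk (Equiv.Perm.SameCycle.setoid σ) x).out
    have hr : ∀ x, σ.SameCycle (r x) x := fun x => Quotient.mk_out (s := Equiv.Perm.SameCycle.setoid σ) x
    have hrσ : ∀ x, r (σ x) = r x := by
      intro x
      have : (Quotient.mk (Equiv.Perm.SameCycle.setoid σ) (σ x)) =
        (Quotient.mk (Equiv.Perm.SameCycle.setoid σ) x) :=
        Quotient.sound (Equiv.Perm.sameCycle_apply_left.2 (Equiv.Perm.SameCycle.refl _ _))
      simp only [r, this]
    choose k hk using hr
    refine ⟨fun x => decide (Even (k x)), fun t => ?_⟩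
    rw [← hσ]
    set x := a t
    have h1 := hk (σ x)
    have h2 := hk x
    rw [hrσ] at h1
    have h3 : (σ ^ (k (σ x) - (k x + 1))) (r x) = r x := by
      rw [sub_eq_neg_add, zpow_add, Equiv.Perm.mul_apply, h1, zpow_neg, Equiv.Perm.inv_eq_iff_eq,
        add_comm (k x), zpow_add, Equiv.Perm.mul_apply, h2, zpow_one]
    have h4 := (MulAction.zpow_smul_eq_iff_minimalPeriod_dvd (a := σ) (b := r x)
            (n := (k (σ x) - (k x + 1)))).1 h3
    have h5 : Even (Function.minimalPeriod σ (r x)) := Nat.not_odd_iff_even.1 (hodd (r x))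
    have h6 : Even (k (σ x) - (k x + 1)) := by
      rw [even_iff_two_dvd] at h5 ⊢
      exact (Int.natCast_dvd_natCast.2 h5).trans h4
    intro h
    simp only [decide_eq_decide] at h
    rw [Int.even_sub, Int.even_add_one] at h6
    tauto

namespace Setup
variable (St : Setup) {S : Set St.ι} {π : Flag St.ends → ℕ}
  (hπ : St.PiS S π)

lemma mem_Mpi (t : St.ι) : t ∈ St.MpiT π ↔ St.isEdgeThread t ∧ π (St.fL t 0) = 1 ∧
    π (St.fR t (Fin.last _)) = 1 := by
  unfold MpiT
  rw [Set.mem_ofPred_eq, head_eq, tail_eq]; rfl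

lemma endF_branch (p : St.ι × Bool) (h : St.isEdgeThread p.1) : (St.endF p).1.1 ∈ St.branchV := by
  refine ⟨p.1, h, ?_⟩
  have := St.endF_vert p
  split_ifs at this
  · exact Or.inr this
  · exact Or.inl this

open Classical in
/-- the end of a thread of `D_π` with label `0` -/
noncomputable def zE (π : Flag St.ends → ℕ) (t : St.ι) : Flag St.ends :=
  St.endF (t, if π (St.fL t 0) = 0 then false else true)

open Classical in
/-- the end of a thread of `D_π` with label `2` -/
noncomputable def tE (π : Flag St.ends → ℕ) (t : St.ι) : Flag St.ends :=
  St.endF (t, if π (St.fL t 0) = 0 then true else false)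

lemma zE_inj {t t' : St.ι} (h : St.zE π t = St.zE π t') : t = t' :=
  congrArg Prod.fst (St.endF_inj h)
lemma tE_inj {t t' : St.ι} (h : St.tE π t = St.tE π t') : t = t' :=
  congrArg Prod.fst (St.endF_inj h)

lemma sym_ends (t : St.ι) :
    s(St.headV t, St.tailV t) = s((St.zE π t).1.1, (St.tE π t).1.1) := by
  rw [headV_eq, tailV_eq, zE, tE]
  split_ifs
  · rfl
  · exact Sym2.eq_swap


lemma Mpi_end (hM : St.MatchingHyps) (hπ : St.PiS S π)
    (p : St.ι × Bool) (hp : St.isEdgeThread p.1) :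
    p.1 ∈ St.MpiT π ↔ π (St.endF p) = 1 := by
  rw [mem_Mpi]
  have := St.type_sum hM hπ p.1 hp
  obtain ⟨t, b⟩ := p
  cases b <;> simp [endF, hp] at * <;> omega

lemma Dpi_labels (hM : St.MatchingHyps) (hπ : St.PiS S π)
    (t : St.ι) (ht : t ∈ St.DpiT π) : π (St.zE π t) = 0 ∧ π (St.tE π t) = 2 := by
  obtain ⟨h1, h2⟩ := ht
  rw [mem_Mpi] at h2
  have := St.type_sum hM hπ t h1
  have h3 : ¬ (π (St.fL t 0) = 1 ∧ π (St.fR t (Fin.last _)) = 1) := fun h => h2 ⟨h1, h⟩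
  unfold zE tE
  split_ifs with h <;> simp [endF] <;> omega

lemma Mpi_count (hM : St.MatchingHyps) (hπ : St.PiS S π) (x : St.V) (hx : x ∈ St.branchV) :
    St.endCount (fun t => t ∈ St.MpiT π) x = 1 := by
  obtain ⟨f, hf, hl⟩ := star_exists St.cubic hπ.1 x 1 (by norm_num)
  obtain ⟨p, hp, rfl⟩ := St.branch_flag hM f (hf ▸ hx)
  unfold endCount
  rw [Set.ncard_eq_one]
  refine ⟨p, ?_⟩
  ext q
  simp only [Set.mem_ofPred_eq, Set.mem_singleton_iff]
  constructor
  · rintro ⟨h1, h2⟩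
    rw [endF_vert] at h2
    have h3 := (St.Mpi_end hM hπ q h1.1).1 h1
    exact St.endF_inj (star_inj St.cubic hπ.1 (h2.trans hf.symm) (h3.trans hl.symm))
  · rintro rfl
    exact ⟨(St.Mpi_end hM hπ q hp).2 hl, by rw [endF_vert]; exact hf⟩

lemma Dpi_count (hM : St.MatchingHyps) (hπ : St.PiS S π) (x : St.V) (hx : x ∈ St.branchV) :
    St.endCount (fun t => St.isEdgeThread t ∧ ¬ t ∈ St.MpiT π) x = 2 := by
  have h1 := St.Mpi_count hM hπ x hx
  have h2 := St.endCount_edge hM x hx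
  unfold endCount at *
  have : {p : St.ι × Bool | St.isEdgeThread p.1 ∧ (if p.2 then St.tailV p.1 else St.headV p.1) = x}
    = {p : St.ι × Bool | p.1 ∈ St.MpiT π ∧ (if p.2 then St.tailV p.1 else St.headV p.1) = x} ∪
      {p : St.ι × Bool | (St.isEdgeThread p.1 ∧ ¬ p.1 ∈ St.MpiT π) ∧
        (if p.2 then St.tailV p.1 else St.headV p.1) = x} := by
    ext p
    have : p.1 ∈ St.MpiT π → St.isEdgeThread p.1 := fun h => h.1
    simp only [Set.mem_ofPred_eq, Set.mem_union]
    tauto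
  rw [this, Set.ncard_union_eq ?_ (Set.toFinite _) (Set.toFinite _), h1] at h2
  · exact Nat.add_left_cancel (h2.trans (show 3 = 1 + 2 from rfl))
  · rw [Set.disjoint_left]
    rintro p ⟨hp, -⟩ ⟨hp', -⟩
    exact hp'.2 hp

lemma bip_or_odd (hM : St.MatchingHyps) (hπ : St.PiS S π)
    : (∃ c : St.V → Bool, ∀ t, t ∈ St.DpiT π → c (St.headV t) ≠ c (St.tailV t)) ∨
    ∃ C : Set St.ι, St.IsOddCycleComponent (St.DpiT π) C := by
  classical
  let a₀ : St.DpiT π → St.branchV := fun t => ⟨(St.zE π t.1).1.1, St.endF_branch _ t.2.1⟩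
  let b : St.DpiT π → St.branchV := fun t => ⟨(St.tE π t.1).1.1, St.endF_branch _ t.2.1⟩
  have ha : Function.Bijective a₀ := by
    constructor
    · intro t t' h
      apply Subtype.ext
      refine St.zE_inj (π := π) (star_inj St.cubic hπ.1 (congrArg Subtype.val h) ?_)
      rw [(St.Dpi_labels hM hπ t t.2).1, (St.Dpi_labels hM hπ t' t'.2).1]
    · rintro ⟨x, hx⟩
      obtain ⟨f, hf, hl⟩ := star_exists St.cubic hπ.1 x 0 (by norm_num)
      obtain ⟨p, hp, rfl⟩ := St.branch_flag hM f (hf ▸ hx)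
      have hD : p.1 ∈ St.DpiT π := by
        refine ⟨hp, fun h => ?_⟩
        rw [St.Mpi_end hM hπ p hp, hl] at h
        exact absurd h (by norm_num)
      refine ⟨⟨p.1, hD⟩, Subtype.ext ?_⟩
      have hsum := St.type_sum hM hπ p.1 hp
      have : St.zE π p.1 = St.endF p := by
        obtain ⟨t, bb⟩ := p
        unfold zE
        cases bb
        · rw [if_pos]; simpa [endF] using hl
        · rw [if_neg]
          simp [endF] at hl hsum
          simp
          omega
      simp only [a₀]
      rw [this]; exact hf
  have hb : Function.Injective b := by
    intro t t' h
    apply Subtype.ext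
    refine St.tE_inj (π := π) (star_inj St.cubic hπ.1 (congrArg Subtype.val h) ?_)
    rw [(St.Dpi_labels hM hπ t t.2).2, (St.Dpi_labels hM hπ t' t'.2).2]
  rcases two_factor (Equiv.ofBijective a₀ ha) b hb with ⟨c, hc⟩ | ⟨C, n, hn, ⟨vs, es, h1, h2, h3, h4, h5⟩, h6⟩
  · left
    refine ⟨fun v => if h : v ∈ St.branchV then c ⟨v, h⟩ else true, fun t ht => ?_⟩
    have h1 := hc ⟨t, ht⟩
    have h2 := St.sym_ends (π := π) t
    have hz : (St.zE π t).1.1 ∈ St.branchV := (a₀ ⟨t, ht⟩).2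
    have ht' : (St.tE π t).1.1 ∈ St.branchV := (b ⟨t, ht⟩).2
    have h1' : c ⟨_, hz⟩ ≠ c ⟨_, ht'⟩ := h1
    rw [Sym2.eq_iff] at h2
    rcases h2 with ⟨e1, e2⟩ | ⟨e1, e2⟩
    · rw [e1, e2]; beta_reduce; rw [dif_pos hz, dif_pos ht']; exact h1'
    · rw [e1, e2]; beta_reduce; rw [dif_pos hz, dif_pos ht']; exact h1'.symm
  · right
    refine ⟨Subtype.val '' C, ⟨?_, n, hn, fun i => (vs i).1, fun i => (es i).1,
      Subtype.val_injective.comp h1, Subtype.val_injective.comp h2, fun i => ⟨_, h3 i, rfl⟩, ?_, ?_⟩,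
      ?_, ?_⟩
    · rintro _ ⟨t, -, rfl⟩; exact t.2.1
    · rintro _ ⟨t, ht, rfl⟩
      obtain ⟨i, rfl⟩ := h4 t ht
      exact ⟨i, rfl⟩
    · intro i
      rw [St.sym_ends (π := π)]
      have e1 := congrArg Subtype.val (h5 i).1
      have e2 := congrArg Subtype.val (h5 i).2
      exact congrArg₂ (fun x y => s(x, y)) e1 e2
    · rintro _ ⟨t, -, rfl⟩; exact t.2
    · rintro _ ⟨t, ht, rfl⟩ t' ht' h
      refine ⟨⟨t', ht'⟩, h6 t ht ⟨t', ht'⟩ ?_, rfl⟩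
      have e1 := St.sym_ends (π := π) t.1
      have e2 := St.sym_ends (π := π) t'
      simp only [Equiv.ofBijective_apply, Subtype.ext_iff, a₀, b]
      rw [Sym2.eq_iff] at e1 e2
      rcases e1 with ⟨x1, x2⟩ | ⟨x1, x2⟩ <;> rcases e2 with ⟨y1, y2⟩ | ⟨y1, y2⟩ <;>
        rw [x1, x2, y1, y2] at h <;> tauto

lemma main (hM : St.MatchingHyps) (hπ : St.PiS S π) (hT : ∃ t : St.ι, St.RestrIsPi'11 t π) :
    ∃ C : Set St.ι, St.IsOddCycleComponent (St.DpiT π) C := by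
  rcases St.bip_or_odd hM hπ with ⟨c, hc⟩ | h
  swap
  · exact h
  exfalso
  obtain ⟨t, hk, hr⟩ := hT
  have ho : (St.kind t).order = 1 := by rw [hk]; rfl
  have hL : ∀ k, π (St.fL t k) = 1 := by
    intro k
    have := hr (kL _ k)
    rw [proj_kL] at this
    exact this
  have hR : ∀ k, π (St.fR t k) = if (k : ℕ) = 0 then 0 else 1 := by
    intro k
    have := hr (kR _ k)
    rw [proj_kR] at this
    rw [fR, this]
    simp only [pi'11]
    split_ifs <;> rfl
  have hcls : St.cls t = .dOdd := by
    rcases hcl : St.cls t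
    · have := St.cls_t1 t hcl; rw [hk] at this; cases this
    · obtain ⟨m, -, h⟩ := St.cls_circOdd t hcl; rw [hk] at h; cases h
    · obtain ⟨m, -, -, h⟩ := St.cls_circEven t hcl; rw [hk] at h; cases h
    · have := St.cls_m0 t hcl; rw [hk] at this; cases this
    · exfalso
      have e1 := St.exp_E hπ t (Fin.last _)
      rw [St.W_w11 S t (Or.inr hcl), hL, hR] at e1
      simp [w11, ho] at e1
    · rfl
    · obtain ⟨m, -, h2, h⟩ := St.cls_dEven t hcl
      rw [hk] at h; cases h; omega
    · have := St.cls_d0 t hcl; rw [hk] at this; cases this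
  have hedge : St.isEdgeThread t := Or.inr (Or.inr (Or.inl hcls))
  have htM : t ∈ St.MpiT π := by
    rw [mem_Mpi]
    refine ⟨hedge, hL _, ?_⟩
    rw [hR]; simp [ho]
  have hge : ∀ s, St.cls s = .mge1 → s ∈ St.MpiT π := by
    intro s hs
    have he : St.isEdgeThread s := Or.inr (Or.inl hs)
    rw [St.Mpi_end hM hπ (s, false) he]
    simpa [endF] using St.mge1_head hM hπ s hs
  have hmax := hM.2.2.2.2.1 (fun s => s ∈ St.MpiT π) (fun s h => h.1)
    (by
      intro s m k hk he
      apply hge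
      rcases St.injured_cls s m k hk with h | h
      · unfold isEdgeThread at he; simp [h] at he
      · exact h)
    (St.Mpi_count hM hπ) (St.Dpi_count hM hπ) ⟨c, fun s h1 h2 => hc s ⟨h1, h2⟩⟩
  refine absurd hmax (not_le.2 (Set.ncard_lt_ncard ?_ (Set.toFinite _)))
  rw [Set.ssubset_iff_of_subset]
  · refine ⟨t, ⟨htM, by omega⟩, ?_⟩
    rintro ⟨h, -⟩
    unfold inM at h
    simp [hcls] at h
  · rintro s ⟨h, h'⟩
    refine ⟨hge s ?_, h'⟩
    rcases h with h | h
    · rw [St.cls_m0 s h] at h'; simp [GK.order] at h'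
    · exact h

end Setup
end FLL


open FLL FLL.Thread

/-- Lemma 5.4.  Let `S ⊆ 𝒯^D_odd` and `π ∈ Π_S`.  If some general
thread of `G` receives the exceptional restriction `π′_11` under `π`, then some connected
component of the 2-factor `D_π` is an odd cycle of the derived graph `Ḡ`. -/
theorem statement15 (St : FLL.Setup) (hM : St.MatchingHyps)
    (S : Set St.ι) (hS : ∀ t ∈ S, St.cls t = TClass.dOdd)
    (π : FLL.Flag St.ends → ℕ) (hπ : St.PiS S π)
    (hT : ∃ t : St.ι, St.RestrIsPi'11 t π) :
    ∃ C : Set St.ι, St.IsOddCycleComponent (St.DpiT π) C := by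
  exact FLL.Setup.main St hM hπ hT
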